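/- Let l ≥ 0 and 0 = i_0 < i_1 < … < i_l < i_{l+1} = k be fixed integers and T(n) := T_{[i_0,…,i_{l+1}]}(n; α). Then as n → ∞, 𝔼(y_{n+1}^{l+2} T(n)) = n/M_n^{2l+4} − (k − 2l − 3) n/M_n^{2l+5} + O(n/M_n^{2l+6}), and 𝔼(T(n)^2) = n^2/M_n^{2l+4} − (2k − 4l − 6) n^2/M_n^{2l+5} + O(n^2/M_n^{2l+6}); consequently Var(T(n)) = O(n^2/M_n^{2l+6}). -/

import Mathlib

open MeasureTheory Filter Finset Asymptotics
open scoped Classical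

/-- `y_m(α) = ∏_{j ∈ α, j < m} (1 - 1/j)` (empty product = 1). -/
noncomputable def hawkinsY (A : Set ℕ) (m : ℕ) : ℝ :=
  ∏ j ∈ Finset.range m, if j ∈ A then 1 - 1 / (j : ℝ) else 1

/-- The σ-algebra generated by the events `{j ∈ α}` for `2 ≤ j < m`. -/
def sieveSigma {Ω : Type*} (α : Ω → Set ℕ) (m : ℕ) : MeasurableSpace Ω :=
  MeasurableSpace.generateFrom {s | ∃ j : ℕ, 2 ≤ j ∧ j < m ∧ s = {ω | j ∈ α ω}}

/-- Wunderlich's model of the Hawkins random sieve: a probability space `(Ω, μ)` with a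
random subset `α` of `{2,3,4,…}` such that `μ(2 ∈ α) = 1` and, for every `m ≥ 2`, the
conditional probability of `{m ∈ α}` given the σ-algebra generated by the events
`{j ∈ α}`, `2 ≤ j < m`, equals `y_m(α)`. -/
structure IsHawkinsSieve {Ω : Type*} [MeasurableSpace Ω] (μ : Measure Ω)
    (α : Ω → Set ℕ) : Prop where
  isProb : IsProbabilityMeasure μ
  meas : ∀ n : ℕ, MeasurableSet {ω | n ∈ α ω}
  mem_ge_two : ∀ ω, ∀ n ∈ α ω, 2 ≤ n
  two_mem : μ {ω | 2 ∈ α ω} = 1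
  condExp_mem : ∀ m : ℕ, 2 ≤ m →
    μ[Set.indicator {ω | m ∈ α ω} (fun _ => (1 : ℝ)) | sieveSigma α m]
      =ᵐ[μ] fun ω => hawkinsY (α ω) m

/-- `M_k = 1 + ∑_{j=1}^{k-2} 1/j` (so `M_2 = 1`). -/
noncomputable def Mharm (k : ℕ) : ℝ := 1 + ∑ j ∈ Finset.Icc 1 (k - 2), 1 / (j : ℝ)

/-- `m[i_0,…,i_{l+1}] ∈ α`: for every `h ∈ [0, k]`, `m + h ∈ α` iff `h` is one of the
values `i_0, …, i_{l+1}`. -/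
def patMem (A : Set ℕ) (l k : ℕ) (i : ℕ → ℕ) (m : ℕ) : Prop :=
  ∀ h : ℕ, h ≤ k → (m + h ∈ A ↔ ∃ j : ℕ, j ≤ l + 1 ∧ i j = h)

/-- `T_{[i_0,…,i_{l+1}]}(n; α) = #{m ≤ n : m[i_0,…,i_{l+1}] ∈ α}`. -/
noncomputable def hawkinsT (A : Set ℕ) (l k : ℕ) (i : ℕ → ℕ) (n : ℕ) : ℕ :=
  ((Finset.range (n + 1)).filter fun m => patMem A l k i m).card

theorem Mharm_succ {m : ℕ} (hm : 2 ≤ m) : Mharm (m + 1) = Mharm m + 1 / ((m : ℝ) - 1) := by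
  obtain ⟨k, rfl⟩ := Nat.exists_eq_add_of_le' hm
  unfold Mharm
  rw [show k + 2 + 1 - 2 = k + 1 by omega, show k + 2 - 2 = k by omega,
    Finset.sum_Icc_succ_top (by omega)]
  push_cast
  ring_nf

theorem one_le_Mharm (n : ℕ) : 1 ≤ Mharm n := by
  unfold Mharm
  have : 0 ≤ ∑ j ∈ Finset.Icc 1 (n - 2), 1 / (j : ℝ) := Finset.sum_nonneg fun _ _ => by positivity
  linarith

theorem Mharm_pos (n : ℕ) : 0 < Mharm n := lt_of_lt_of_le one_pos (one_le_Mharm n)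

theorem inv_Mharm_nonneg (n : ℕ) : 0 ≤ (Mharm n)⁻¹ := inv_nonneg.2 (Mharm_pos n).le

theorem inv_Mharm_le_one (n : ℕ) : (Mharm n)⁻¹ ≤ 1 := inv_le_one_of_one_le₀ (one_le_Mharm n)

theorem Mharm_eq_harmonic (n : ℕ) : Mharm n = 1 + (harmonic (n - 2) : ℝ) := by
  rw [Mharm, harmonic_eq_sum_Icc]
  push_cast
  simp

theorem Mharm_le_log (n : ℕ) : Mharm n ≤ 2 + Real.log n := by
  rw [Mharm_eq_harmonic]
  have h1 := harmonic_le_one_add_log (n - 2)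
  have h2 : Real.log ((n - 2 : ℕ) : ℝ) ≤ Real.log n := by
    rcases Nat.eq_zero_or_pos (n - 2) with h | h
    · rw [h]
      simpa using Real.log_natCast_nonneg n
    · exact Real.log_le_log (by exact_mod_cast h) (by exact_mod_cast Nat.sub_le n 2)
  linarith

theorem tendsto_Mharm : Tendsto Mharm atTop atTop := by
  have h1 : Tendsto (fun n : ℕ => Real.log ((n - 2 + 1 : ℕ) : ℝ)) atTop atTop :=
    Real.tendsto_log_atTop.comp (tendsto_natCast_atTop_atTop.comp
      (tendsto_atTop_mono (fun n => by omega) (tendsto_sub_atTop_nat 2)))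
  refine tendsto_atTop_mono (fun n => ?_) h1
  rw [Mharm_eq_harmonic]
  have := log_add_one_le_harmonic (n - 2)
  push_cast at this ⊢
  linarith

/-- Powers of `Mharm` grow slower than `√n`. -/
theorem Mharm_pow_le_sqrt (r : ℕ) : ∃ C : ℝ, 0 < C ∧ ∀ n : ℕ, 1 ≤ n → Mharm n ^ r ≤ C * √n := by
  refine ⟨(2 + 2 * ((r : ℝ) + 1)) ^ (r + 1), by positivity, fun n hn => ?_⟩
  have hn1 : (1 : ℝ) ≤ n := by exact_mod_cast hn
  set e : ℝ := 1 / (2 * ((r : ℝ) + 1)) with he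
  have he0 : 0 < e := by positivity
  have hlog : Real.log n ≤ (n : ℝ) ^ e / e := Real.log_le_rpow_div (by positivity) he0
  have hone : (1 : ℝ) ≤ (n : ℝ) ^ e := Real.one_le_rpow hn1 he0.le
  have hM : Mharm n ≤ (2 + 2 * ((r : ℝ) + 1)) * (n : ℝ) ^ e := by
    have : (n : ℝ) ^ e / e = 2 * ((r : ℝ) + 1) * (n : ℝ) ^ e := by
      rw [he]; field_simp
    have := Mharm_le_log n
    linarith
  calc Mharm n ^ r ≤ Mharm n ^ (r + 1) := pow_le_pow_right₀ (one_le_Mharm n) (by omega)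
    _ ≤ ((2 + 2 * ((r : ℝ) + 1)) * (n : ℝ) ^ e) ^ (r + 1) :=
      pow_le_pow_left₀ (Mharm_pos n).le hM _
    _ = (2 + 2 * ((r : ℝ) + 1)) ^ (r + 1) * √n := by
      rw [mul_pow, ← Real.rpow_natCast ((n : ℝ) ^ e), ← Real.rpow_mul (by positivity),
        Real.sqrt_eq_rpow]
      congr 2
      rw [he]
      push_cast
      field_simp

/-- Powers of `Mharm` grow slower than `n`. -/
theorem one_le_mul_inv_Mharm_pow (r : ℕ) :
    ∃ C : ℝ, 0 < C ∧ ∀ n : ℕ, 1 ≤ n → 1 ≤ C * (n * (Mharm n)⁻¹ ^ r) := by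
  obtain ⟨C, hC, h⟩ := Mharm_pow_le_sqrt r
  refine ⟨C, hC, fun n hn => ?_⟩
  have hn1 : (1 : ℝ) ≤ n := by exact_mod_cast hn
  have h2 : √(n : ℝ) ≤ n := Real.sqrt_le_iff.2 ⟨by positivity, by nlinarith⟩
  have h3 : Mharm n ^ r ≤ C * n := (h n hn).trans (mul_le_mul_of_nonneg_left h2 hC.le)
  have h4 : 0 < Mharm n ^ r := pow_pos (Mharm_pos n) r
  rw [inv_pow, ← mul_assoc, ← div_eq_mul_inv, le_div_iff₀ h4]
  linarith

theorem summable_Mharm_div_sq : Summable fun m : ℕ => Mharm m / ((m : ℝ) - 1) ^ 2 := by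
  obtain ⟨C, hC, h⟩ := Mharm_pow_le_sqrt 1
  have hs : Summable fun m : ℕ => 4 * C * (1 / (m : ℝ) ^ (3 / 2 : ℝ)) :=
    (Real.summable_one_div_nat_rpow.2 (by norm_num)).mul_left _
  refine Summable.of_norm_bounded_eventually_nat hs ?_
  filter_upwards [eventually_ge_atTop 2] with m hm
  have hm2 : (2 : ℝ) ≤ m := by exact_mod_cast hm
  have h1 := h m (by omega)
  rw [pow_one] at h1
  have h2 : (m : ℝ) ^ 2 ≤ 4 * ((m : ℝ) - 1) ^ 2 := by nlinarith
  have h3 : (m : ℝ) ^ 2 = (m : ℝ) ^ (3 / 2 : ℝ) * √m := by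
    rw [Real.sqrt_eq_rpow, ← Real.rpow_add (by positivity)]
    norm_num
  have h4 : 0 < (m : ℝ) ^ (3 / 2 : ℝ) := by positivity
  have h5 : 0 < √(m : ℝ) := Real.sqrt_pos.2 (by linarith)
  have h6 : 0 < ((m : ℝ) - 1) ^ 2 := by nlinarith
  rw [Real.norm_of_nonneg (div_nonneg (Mharm_pos m).le h6.le), div_le_iff₀ h6, mul_one_div,
    div_mul_eq_mul_div, le_div_iff₀ h4]
  calc Mharm m * (m : ℝ) ^ (3 / 2 : ℝ) ≤ C * √m * (m : ℝ) ^ (3 / 2 : ℝ) := by gcongr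
    _ = C * (m : ℝ) ^ 2 := by rw [h3]; ring
    _ ≤ C * (4 * ((m : ℝ) - 1) ^ 2) := by gcongr
    _ = 4 * C * ((m : ℝ) - 1) ^ 2 := by ring

/-- Second-order expansion of `a ^ r = (1 / b + D) ^ (-r)` around `b ^ r`. -/
theorem abs_pow_sub_expansion_le {a b D : ℝ} (ha : 0 ≤ a) (ha1 : a ≤ 1) (hb : 0 ≤ b)
    (hab : a = b - D * a * b) (r : ℕ) :
    |a ^ r - b ^ r + r * D * b ^ (r + 1)| ≤ (r : ℝ) ^ 2 * D ^ 2 * b ^ (r + 2) * (1 + |D|) ^ r := by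
  have hale : a ≤ b * (1 + |D|) := by
    have h1 : -D * a ≤ |D| :=
      calc -D * a ≤ |D| * a := by gcongr; exact neg_le_abs D
        _ ≤ |D| := mul_le_of_le_one_right (abs_nonneg D) ha1
    nlinarith
  induction r with
  | zero => simp
  | succ r ih =>
    have hkey : a ^ (r + 1) - b ^ (r + 1) + ((r + 1 : ℕ) : ℝ) * D * b ^ (r + 1 + 1) =
        a * (a ^ r - b ^ r + r * D * b ^ (r + 1)) + (r + 1) * D ^ 2 * a * b ^ (r + 2) := by
      push_cast
      have h2 : a * b ^ r - b ^ (r + 1) = -D * a * b ^ (r + 1) := by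
        rw [pow_succ]
        linear_combination b ^ r * hab
      have h3 : b - a = D * a * b := by linarith
      linear_combination h2 + (r + 1) * D * b ^ (r + 1) * h3
    rw [hkey]
    set E : ℝ := 1 + |D| with hE
    have hE1 : 1 ≤ E := by linarith [abs_nonneg D]
    have h4 : |a * (a ^ r - b ^ r + r * D * b ^ (r + 1))| ≤
        b * E * ((r : ℝ) ^ 2 * D ^ 2 * b ^ (r + 2) * E ^ r) := by
      rw [abs_mul, abs_of_nonneg ha]
      gcongr
    have h5 : |(r + 1) * D ^ 2 * a * b ^ (r + 2)| ≤
        (r + 1) * D ^ 2 * (b * E ^ (r + 1)) * b ^ (r + 2) := by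
      rw [abs_of_nonneg (by positivity)]
      have : a ≤ b * E ^ (r + 1) := hale.trans (by gcongr; exact le_self_pow₀ hE1 (by omega))
      gcongr
    refine (abs_add_le _ _).trans ((add_le_add h4 h5).trans ?_)
    have h6 : 0 ≤ D ^ 2 * b ^ (r + 3) * E ^ (r + 1) := by positivity
    push_cast
    have h7 : (0 : ℝ) ≤ r := by positivity
    calc _ = ((r : ℝ) ^ 2 + (r + 1)) * (D ^ 2 * b ^ (r + 3) * E ^ (r + 1)) := by ring
      _ ≤ ((r : ℝ) + 1) ^ 2 * (D ^ 2 * b ^ (r + 3) * E ^ (r + 1)) := by gcongr; nlinarith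
      _ = _ := by ring

theorem inv_Mharm_eq {m : ℕ} (hm : 2 ≤ m) : (Mharm m)⁻¹ =
    (Mharm (m + 1))⁻¹ - (-(1 / ((m : ℝ) - 1))) * (Mharm m)⁻¹ * (Mharm (m + 1))⁻¹ := by
  have h1 := (Mharm_pos m).ne'
  have h2 := (Mharm_pos (m + 1)).ne'
  have h3 := Mharm_succ hm
  field_simp
  linarith

theorem inv_Mharm_succ_le {m : ℕ} (hm : 2 ≤ m) : (Mharm (m + 1))⁻¹ ≤ (Mharm m)⁻¹ := by
  have hm2 : (2 : ℝ) ≤ m := by exact_mod_cast hm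
  refine inv_anti₀ (Mharm_pos m) ?_
  rw [Mharm_succ hm]
  have : 0 ≤ 1 / ((m : ℝ) - 1) := div_nonneg one_pos.le (by linarith)
  linarith

/-- The increments of `Mharm ^ (-r)` up to second order. -/
theorem abs_inv_Mharm_pow_sub_le {m : ℕ} (hm : 2 ≤ m) (r : ℕ) :
    |(Mharm m)⁻¹ ^ r - (Mharm (m + 1))⁻¹ ^ r
      - r * (1 / ((m : ℝ) - 1)) * (Mharm (m + 1))⁻¹ ^ (r + 1)|
      ≤ (r : ℝ) ^ 2 * 2 ^ r * (1 / ((m : ℝ) - 1)) ^ 2 := by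
  have hm2 : (2 : ℝ) ≤ m := by exact_mod_cast hm
  have ht : 0 ≤ 1 / ((m : ℝ) - 1) := div_nonneg one_pos.le (by linarith)
  have ht1 : 1 / ((m : ℝ) - 1) ≤ 1 := by rw [div_le_one (by linarith)]; linarith
  have := abs_pow_sub_expansion_le (inv_Mharm_nonneg m) (inv_Mharm_le_one m)
    (inv_Mharm_nonneg (m + 1)) (inv_Mharm_eq hm) r
  rw [abs_neg, abs_of_nonneg ht, neg_sq] at this
  set t := 1 / ((m : ℝ) - 1)
  calc _ = |(Mharm m)⁻¹ ^ r - (Mharm (m + 1))⁻¹ ^ r + r * (-t) * (Mharm (m + 1))⁻¹ ^ (r + 1)| := by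
        congr 1; ring
    _ ≤ _ := this
    _ ≤ (r : ℝ) ^ 2 * t ^ 2 * 1 * 2 ^ r := by
      have h1 : (Mharm (m + 1))⁻¹ ^ (r + 2) ≤ 1 :=
        pow_le_one₀ (inv_Mharm_nonneg _) (inv_Mharm_le_one _)
      have h2 : 1 + t ≤ 2 := by linarith
      gcongr
    _ = _ := by ring

theorem abs_inv_Mharm_pow_sub_succ_le {m : ℕ} (hm : 2 ≤ m) (r : ℕ) :
    |(Mharm (m + 1))⁻¹ ^ r - (Mharm m)⁻¹ ^ r| ≤ (r + (r : ℝ) ^ 2 * 2 ^ r) * (1 / ((m : ℝ) - 1)) := by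
  have hm2 : (2 : ℝ) ≤ m := by exact_mod_cast hm
  have ht : 0 ≤ 1 / ((m : ℝ) - 1) := div_nonneg one_pos.le (by linarith)
  have ht1 : 1 / ((m : ℝ) - 1) ≤ 1 := by rw [div_le_one (by linarith)]; linarith
  have h := abs_inv_Mharm_pow_sub_le hm r
  set t := 1 / ((m : ℝ) - 1)
  have h1 : (Mharm (m + 1))⁻¹ ^ (r + 1) ≤ 1 :=
    pow_le_one₀ (inv_Mharm_nonneg _) (inv_Mharm_le_one _)
  have h0 : 0 ≤ (Mharm (m + 1))⁻¹ ^ (r + 1) := pow_nonneg (inv_Mharm_nonneg _) _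
  have h2 : r * t * (Mharm (m + 1))⁻¹ ^ (r + 1) ≤ r * t :=
    mul_le_of_le_one_right (by positivity) h1
  have h2' : 0 ≤ r * t * (Mharm (m + 1))⁻¹ ^ (r + 1) := by positivity
  have h3 : (r : ℝ) ^ 2 * 2 ^ r * t ^ 2 ≤ (r : ℝ) ^ 2 * 2 ^ r * t := by
    gcongr; nlinarith
  rw [abs_le] at h ⊢
  constructor <;> nlinarith [h.1, h.2]

/-- `Σ_{m ≤ n} M_m ^ (-r)`. -/
noncomputable def sumInvMharm (r n : ℕ) : ℝ := ∑ m ∈ Finset.range (n + 1), (Mharm m)⁻¹ ^ r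

theorem sumInvMharm_succ (r n : ℕ) :
    sumInvMharm r (n + 1) = sumInvMharm r n + (Mharm (n + 1))⁻¹ ^ r :=
  Finset.sum_range_succ _ _

theorem sumInvMharm_le (r : ℕ) :
    ∃ C : ℝ, 0 < C ∧ ∀ n : ℕ, 2 ≤ n → sumInvMharm r n ≤ C * (n * (Mharm n)⁻¹ ^ r) := by
  obtain ⟨N, hN⟩ := eventually_atTop.1 ((tendsto_atTop.1 tendsto_Mharm) (6 * r))
  obtain ⟨C₀, hC₀, h₀⟩ := one_le_mul_inv_Mharm_pow r
  have hnn : ∀ n : ℕ, 0 ≤ n * (Mharm n)⁻¹ ^ r := fun n =>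
    mul_nonneg (by positivity) (pow_nonneg (inv_Mharm_nonneg n) r)
  refine ⟨2 + C₀ * (N + 3), by positivity, fun n hn => ?_⟩
  set C := 2 + C₀ * (N + 3) with hC
  have hC2 : 2 ≤ C := by rw [hC]; linarith [show 0 ≤ C₀ * ((N : ℝ) + 3) by positivity]
  have hsmall : ∀ n : ℕ, 2 ≤ n → n ≤ N + 2 → sumInvMharm r n ≤ C * (n * (Mharm n)⁻¹ ^ r) := by
    intro n hn hnN
    have h1 : sumInvMharm r n ≤ n + 1 := by
      calc sumInvMharm r n ≤ ∑ m ∈ Finset.range (n + 1), (1 : ℝ) := Finset.sum_le_sum fun m _ =>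
            pow_le_one₀ (inv_Mharm_nonneg m) (inv_Mharm_le_one m)
        _ = n + 1 := by simp
    have h2 : (n : ℝ) + 1 ≤ N + 3 := by exact_mod_cast Nat.succ_le_succ hnN
    have h3 := h₀ n (by omega)
    have h4 : (N : ℝ) + 3 ≤ (N + 3) * (C₀ * (n * (Mharm n)⁻¹ ^ r)) :=
      le_mul_of_one_le_right (by positivity) h3
    have h5 := hnn n
    rw [hC]
    nlinarith
  rcases le_total n (N + 2) with hle | hle
  · exact hsmall n hn hle
  · induction n, hle using Nat.le_induction with
    | base => exact hsmall _ hn le_rfl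
    | succ n hle ih =>
      have hn2 : 2 ≤ n := by omega
      have ih := ih hn2
      have hn2' : (2 : ℝ) ≤ n := by exact_mod_cast hn2
      rw [sumInvMharm_succ]
      have hb1 : (Mharm (n + 1))⁻¹ ^ r ≤ (Mharm n)⁻¹ ^ r :=
        pow_le_pow_left₀ (inv_Mharm_nonneg _) (inv_Mharm_succ_le hn2) r
      have hMn : 6 * (r : ℝ) ≤ Mharm n := hN n (by omega)
      have hMpos := Mharm_pos n
      have hratio : Mharm (n + 1) = Mharm n * (1 + 1 / (((n : ℝ) - 1) * Mharm n)) := by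
        have : (n : ℝ) - 1 ≠ 0 := by linarith
        rw [Mharm_succ hn2]
        field_simp
      have hpow : Mharm (n + 1) ^ r ≤ Mharm n ^ r * (1 + 1 / (2 * (n : ℝ) + 1)) := by
        rw [hratio, mul_pow]
        refine mul_le_mul_of_nonneg_left ?_ (by positivity)
        have hd : 0 < ((n : ℝ) - 1) * Mharm n := mul_pos (by linarith) hMpos
        calc (1 + 1 / (((n : ℝ) - 1) * Mharm n)) ^ r
            ≤ (Real.exp (1 / (((n : ℝ) - 1) * Mharm n))) ^ r := by
              gcongr
              linarith [Real.add_one_le_exp (1 / (((n : ℝ) - 1) * Mharm n))]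
          _ = Real.exp (r * (1 / (((n : ℝ) - 1) * Mharm n))) := (Real.exp_nat_mul _ _).symm
          _ ≤ Real.exp (1 / (2 * n + 2)) := by
              gcongr
              rw [mul_one_div, div_le_div_iff₀ hd (by linarith)]
              nlinarith
          _ ≤ 1 + 1 / (2 * (n : ℝ) + 1) := by
              have := Real.one_sub_le_exp_neg (1 / (2 * (n : ℝ) + 2))
              rw [Real.exp_neg] at this
              have h7 : 0 < 1 - 1 / (2 * (n : ℝ) + 2) := by
                rw [sub_pos, div_lt_one] <;> linarith
              calc Real.exp (1 / (2 * n + 2)) ≤ (1 - 1 / (2 * (n : ℝ) + 2))⁻¹ := by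
                    rw [← inv_inv (Real.exp _)]
                    exact inv_anti₀ h7 this
                _ = 1 + 1 / (2 * (n : ℝ) + 1) := by
                    rw [show 1 - 1 / (2 * (n : ℝ) + 2) = (2 * n + 1) / (2 * n + 2) by
                      field_simp; ring, inv_div]
                    field_simp
                    ring
      have hpow' : (Mharm n)⁻¹ ^ r ≤ (Mharm (n + 1))⁻¹ ^ r * (1 + 1 / (2 * (n : ℝ) + 1)) := by
        rw [inv_pow, inv_pow, ← div_eq_inv_mul, ← one_div, div_le_div_iff₀ (pow_pos hMpos r)
          (pow_pos (Mharm_pos _) r)]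
        linarith
      have hb0 : 0 ≤ (Mharm (n + 1))⁻¹ ^ r := pow_nonneg (inv_Mharm_nonneg _) r
      set x := (Mharm (n + 1))⁻¹ ^ r
      set y := (Mharm n)⁻¹ ^ r
      calc sumInvMharm r n + x ≤ C * (n * y) + y := add_le_add ih hb1
        _ = (C * n + 1) * y := by ring
        _ ≤ (C * n + 1) * (x * (1 + 1 / (2 * (n : ℝ) + 1))) := by gcongr
        _ ≤ C * (((n + 1 : ℕ) : ℝ) * x) := by
          have : (C * n + 1) * (1 + 1 / (2 * (n : ℝ) + 1)) ≤ C * ((n + 1 : ℕ) : ℝ) := by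
            push_cast
            rw [show (1 : ℝ) + 1 / (2 * (n : ℝ) + 1) = (2 * n + 2) / (2 * n + 1) by
              field_simp; ring, mul_div_assoc', div_le_iff₀ (by linarith)]
            nlinarith
          calc _ = (C * n + 1) * (1 + 1 / (2 * (n : ℝ) + 1)) * x := by ring
            _ ≤ C * ((n + 1 : ℕ) : ℝ) * x := by gcongr
            _ = _ := by ring

/-- Summation by parts: `Σ_{m ≤ n} M_m ^ (-r) = n / M_n ^ r + r Σ_{m ≤ n} M_m ^ (-r-1) + …`. -/
theorem abs_sumInvMharm_sub_le (r : ℕ) : ∃ C : ℝ, 0 < C ∧ ∀ n : ℕ, 2 ≤ n →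
    |sumInvMharm r n - n * (Mharm n)⁻¹ ^ r - r * sumInvMharm (r + 1) n|
      ≤ C * (n * (Mharm n)⁻¹ ^ (r + 2)) := by
  obtain ⟨C₁, hC₁, h₁⟩ := one_le_mul_inv_Mharm_pow (r + 3)
  set f : ℕ → ℝ := fun n => sumInvMharm r n - n * (Mharm n)⁻¹ ^ r - r * sumInvMharm (r + 1) n
    with hf
  set C := |f 2| + (r + 2 * ((r : ℝ) ^ 2 * 2 ^ r)) + 1 with hC
  have hCpos : 0 < C := by positivity
  have hmain : ∀ n : ℕ, 2 ≤ n → |f n| ≤ C * Mharm n := by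
    intro n hn
    induction n, hn using Nat.le_induction with
    | base =>
      have : |f 2| ≤ C := by rw [hC]; linarith [show 0 ≤ r + 2 * ((r : ℝ) ^ 2 * 2 ^ r) by positivity]
      nlinarith [one_le_Mharm 2]
    | succ n hn ih =>
      have hn2 : (2 : ℝ) ≤ n := by exact_mod_cast hn
      have h := abs_inv_Mharm_pow_sub_le hn r
      rw [Mharm_succ hn, mul_add]
      have ht : 0 ≤ 1 / ((n : ℝ) - 1) := div_nonneg one_pos.le (by linarith)
      have hnt : (n : ℝ) * (1 / ((n : ℝ) - 1)) = 1 + 1 / ((n : ℝ) - 1) := by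
        have : (n : ℝ) - 1 ≠ 0 := by linarith
        field_simp
        ring
      have ht1 : 1 / ((n : ℝ) - 1) ≤ 1 := by rw [div_le_one (by linarith)]; linarith
      set t := 1 / ((n : ℝ) - 1)
      set b := (Mharm (n + 1))⁻¹
      have hb0 : 0 ≤ b ^ (r + 1) := pow_nonneg (inv_Mharm_nonneg _) _
      have hb1 : b ^ (r + 1) ≤ 1 := pow_le_one₀ (inv_Mharm_nonneg _) (inv_Mharm_le_one _)
      have hstep : f (n + 1) = f n + (n * ((Mharm n)⁻¹ ^ r - b ^ r - r * t * b ^ (r + 1))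
          + r * t * b ^ (r + 1)) := by
        simp only [hf, sumInvMharm_succ]
        push_cast
        linear_combination (r * b ^ (r + 1)) * hnt
      have h2 : |(n : ℝ) * ((Mharm n)⁻¹ ^ r - b ^ r - r * t * b ^ (r + 1))|
          ≤ 2 * ((r : ℝ) ^ 2 * 2 ^ r) * t := by
        rw [abs_mul, abs_of_nonneg (by positivity : (0 : ℝ) ≤ n)]
        calc _ ≤ n * ((r : ℝ) ^ 2 * 2 ^ r * t ^ 2) := by gcongr
          _ = ((r : ℝ) ^ 2 * 2 ^ r) * t * (n * t) := by ring
          _ ≤ ((r : ℝ) ^ 2 * 2 ^ r) * t * 2 := by gcongr; linarith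
          _ = _ := by ring
      have h3 : |r * t * b ^ (r + 1)| ≤ r * t := by
        rw [abs_of_nonneg (by positivity)]
        exact mul_le_of_le_one_right (by positivity) hb1
      rw [hstep]
      refine (abs_add_le _ _).trans (add_le_add ih ((abs_add_le _ _).trans
        ((add_le_add h2 h3).trans ?_)))
      rw [← add_mul]
      gcongr
      rw [hC]
      linarith [abs_nonneg (f 2)]
  refine ⟨C * C₁, by positivity, fun n hn => (hmain n hn).trans ?_⟩
  have h := h₁ n (by omega)
  have hM := Mharm_pos n
  calc C * Mharm n = C * Mharm n * 1 := by ring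
    _ ≤ C * Mharm n * (C₁ * (n * (Mharm n)⁻¹ ^ (r + 3))) := by gcongr
    _ = C * C₁ * (n * (Mharm n)⁻¹ ^ (r + 2)) * (Mharm n * (Mharm n)⁻¹) := by ring
    _ = _ := by rw [mul_inv_cancel₀ hM.ne', mul_one]

/-- `g A` only depends on `A ∩ [0, m)`. -/
def DeterminedBelow (m : ℕ) (g : Set ℕ → ℝ) : Prop :=
  ∀ A B : Set ℕ, (∀ j < m, (j ∈ A ↔ j ∈ B)) → g A = g B

namespace DeterminedBelow

variable {m n : ℕ} {f g : Set ℕ → ℝ}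

theorem mono (hf : DeterminedBelow m f) (hmn : m ≤ n) : DeterminedBelow n f :=
  fun A B hAB => hf A B fun j hj => hAB j (by omega)

theorem comp (hf : DeterminedBelow m f) (φ : ℝ → ℝ) : DeterminedBelow m fun A => φ (f A) :=
  fun A B hAB => congrArg φ (hf A B hAB)

theorem comp₂ (hf : DeterminedBelow m f) (hg : DeterminedBelow m g) (φ : ℝ → ℝ → ℝ) :
    DeterminedBelow m fun A => φ (f A) (g A) :=
  fun A B hAB => congrArg₂ φ (hf A B hAB) (hg A B hAB)

theorem mul (hf : DeterminedBelow m f) (hg : DeterminedBelow m g) :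
    DeterminedBelow m fun A => f A * g A :=
  hf.comp₂ hg (· * ·)

theorem add (hf : DeterminedBelow m f) (hg : DeterminedBelow m g) :
    DeterminedBelow m fun A => f A + g A :=
  hf.comp₂ hg (· + ·)

theorem sub (hf : DeterminedBelow m f) (hg : DeterminedBelow m g) :
    DeterminedBelow m fun A => f A - g A :=
  hf.comp₂ hg (· - ·)

theorem const (c : ℝ) : DeterminedBelow m fun _ => c := fun _ _ _ => rfl

theorem sum {ι : Type*} {s : Finset ι} {F : ι → Set ℕ → ℝ}
    (hF : ∀ x ∈ s, DeterminedBelow m (F x)) : DeterminedBelow m fun A => ∑ x ∈ s, F x A :=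
  fun A B hAB => Finset.sum_congr rfl fun x hx => hF x hx A B hAB

theorem prod {ι : Type*} {s : Finset ι} {F : ι → Set ℕ → ℝ}
    (hF : ∀ x ∈ s, DeterminedBelow m (F x)) : DeterminedBelow m fun A => ∏ x ∈ s, F x A :=
  fun A B hAB => Finset.prod_congr rfl fun x hx => hF x hx A B hAB

end DeterminedBelow

/-- The indicator of `j ∈ A`. -/
noncomputable def mark (j : ℕ) (A : Set ℕ) : ℝ := if j ∈ A then 1 else 0

theorem mark_nonneg (j : ℕ) (A : Set ℕ) : 0 ≤ mark j A := by
  unfold mark; split_ifs <;> norm_num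

theorem mark_le_one (j : ℕ) (A : Set ℕ) : mark j A ≤ 1 := by
  unfold mark; split_ifs <;> norm_num

theorem determinedBelow_mark {j m : ℕ} (hj : j < m) : DeterminedBelow m (mark j) :=
  fun A B hAB => by simp only [mark, hAB j hj]

theorem determinedBelow_hawkinsY (m : ℕ) : DeterminedBelow m fun A => hawkinsY A m :=
  DeterminedBelow.prod fun j hj A B hAB => by simp only [hAB j (Finset.mem_range.1 hj)]

/-- The deviation of `1 / y_m` from its mean. -/
noncomputable def dev (m : ℕ) (A : Set ℕ) : ℝ := (hawkinsY A m)⁻¹ - Mharm m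

theorem determinedBelow_dev (m : ℕ) : DeterminedBelow m (dev m) :=
  (determinedBelow_hawkinsY m).comp fun y => y⁻¹ - Mharm m

theorem hawkinsY_succ (A : Set ℕ) (m : ℕ) :
    hawkinsY A (m + 1) = hawkinsY A m * if m ∈ A then 1 - 1 / (m : ℝ) else 1 :=
  Finset.prod_range_succ _ _

section Pointwise

variable {A : Set ℕ}

theorem hawkinsY_two (hA : ∀ n ∈ A, 2 ≤ n) : hawkinsY A 2 = 1 := by
  refine Finset.prod_eq_one fun j hj => if_neg fun hjA => ?_
  have := hA j hjA
  have := Finset.mem_range.1 hj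
  omega

theorem hawkinsY_pos (hA : ∀ n ∈ A, 2 ≤ n) (m : ℕ) : 0 < hawkinsY A m := by
  refine Finset.prod_pos fun j _ => ?_
  split_ifs with hj
  · have : (2 : ℝ) ≤ j := by exact_mod_cast hA j hj
    rw [sub_pos, div_lt_one] <;> linarith
  · exact one_pos

theorem hawkinsY_le_one (hA : ∀ n ∈ A, 2 ≤ n) (m : ℕ) : hawkinsY A m ≤ 1 := by
  refine Finset.prod_le_one (fun j _ => ?_) fun j _ => ?_
  all_goals split_ifs with hj
  · have : (2 : ℝ) ≤ j := by exact_mod_cast hA j hj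
    rw [sub_nonneg, div_le_one] <;> linarith
  · exact zero_le_one
  · have : (0 : ℝ) ≤ 1 / j := by positivity
    linarith
  · exact le_rfl

theorem hawkinsY_succ_le (hA : ∀ n ∈ A, 2 ≤ n) (m : ℕ) : hawkinsY A (m + 1) ≤ hawkinsY A m := by
  rw [hawkinsY_succ]
  refine mul_le_of_le_one_right (hawkinsY_pos hA m).le ?_
  split_ifs
  · have : (0 : ℝ) ≤ 1 / m := by positivity
    linarith
  · exact le_rfl

theorem inv_le_hawkinsY (hA : ∀ n ∈ A, 2 ≤ n) {m : ℕ} (hm : 2 ≤ m) : 1 / ((m : ℝ) - 1) ≤ hawkinsY A m := by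
  induction m, hm using Nat.le_induction with
  | base => rw [hawkinsY_two hA]; norm_num
  | succ m hm ih =>
    have hm2 : (2 : ℝ) ≤ m := by exact_mod_cast hm
    have h1 : 1 / (((m + 1 : ℕ) : ℝ) - 1) = 1 / ((m : ℝ) - 1) * (1 - 1 / (m : ℝ)) := by
      have : (m : ℝ) - 1 ≠ 0 := by linarith
      have : (m : ℝ) ≠ 0 := by linarith
      push_cast
      rw [add_sub_cancel_right]
      field_simp
    have h2 : 0 ≤ 1 - 1 / (m : ℝ) := by rw [sub_nonneg, div_le_one] <;> linarith
    have h3 : 1 - 1 / (m : ℝ) ≤ if m ∈ A then 1 - 1 / (m : ℝ) else 1 := by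
      split_ifs
      · exact le_rfl
      · have : (0 : ℝ) ≤ 1 / m := by positivity
        linarith
    rw [hawkinsY_succ, h1]
    exact mul_le_mul ih h3 h2 (hawkinsY_pos hA m).le

theorem hawkinsY_add_bounds (hA : ∀ n ∈ A, 2 ≤ n) {m : ℕ} (hm : 1 ≤ m) (t : ℕ) :
    hawkinsY A m - t / m ≤ hawkinsY A (m + t) ∧ hawkinsY A (m + t) ≤ hawkinsY A m := by
  have hm1 : (1 : ℝ) ≤ m := by exact_mod_cast hm
  induction t with
  | zero => simp
  | succ t ih =>
    refine ⟨?_, (hawkinsY_succ_le hA (m + t)).trans ih.2⟩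
    have h1 : hawkinsY A (m + t) - 1 / m ≤ hawkinsY A (m + t + 1) := by
      rw [hawkinsY_succ]
      split_ifs
      · have h2 : (1 : ℝ) / ((m + t : ℕ) : ℝ) ≤ 1 / m := by
          gcongr
          exact Nat.le_add_right m t
        have h3 := hawkinsY_le_one hA (m + t)
        have h4 := hawkinsY_pos hA (m + t)
        have h5 : (0 : ℝ) ≤ 1 / ((m + t : ℕ) : ℝ) := by positivity
        nlinarith
      · have : (0 : ℝ) ≤ 1 / m := by positivity
        linarith
    have h6 : ((t + 1 : ℕ) : ℝ) / m = t / m + 1 / m := by push_cast; ring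
    rw [h6, ← add_assoc]
    linarith [ih.1]

/-- One step of the walk `dev`. -/
theorem dev_succ (hA : ∀ n ∈ A, 2 ≤ n) {m : ℕ} (hm : 2 ≤ m) : dev (m + 1) A =
    dev m A + (mark m A * (hawkinsY A m)⁻¹ - 1) * (1 / ((m : ℝ) - 1)) := by
  have hm2 : (2 : ℝ) ≤ m := by exact_mod_cast hm
  have h1 : (m : ℝ) - 1 ≠ 0 := by linarith
  have hY := (hawkinsY_pos hA m).ne'
  unfold dev mark
  rw [hawkinsY_succ, Mharm_succ hm]
  split_ifs
  · have : 1 - 1 / (m : ℝ) = (m - 1) / m := by field_simp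
    rw [this]
    field_simp
    ring
  · simp
    ring

theorem abs_hawkinsY_pow_sub_expansion_le (hA : ∀ n ∈ A, 2 ≤ n) (m r : ℕ) :
    |hawkinsY A m ^ r - (Mharm m)⁻¹ ^ r + r * dev m A * (Mharm m)⁻¹ ^ (r + 1)|
      ≤ (r : ℝ) ^ 2 * (Mharm m)⁻¹ ^ (r + 2) * (1 + |dev m A|) ^ (r + 2) := by
  have hY := hawkinsY_pos hA m
  have hM := Mharm_pos m
  have := abs_pow_sub_expansion_le (D := dev m A) hY.le (hawkinsY_le_one hA m)
    (inv_Mharm_nonneg m) (by unfold dev; field_simp; ring) r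
  refine this.trans ?_
  have h1 : dev m A ^ 2 ≤ (1 + |dev m A|) ^ 2 := by
    rw [← sq_abs]
    gcongr
    linarith
  have h2 := inv_Mharm_nonneg m
  calc _ ≤ (r : ℝ) ^ 2 * (1 + |dev m A|) ^ 2 * (Mharm m)⁻¹ ^ (r + 2) * (1 + |dev m A|) ^ r := by
        gcongr
    _ = _ := by ring

theorem abs_hawkinsY_pow_sub_le (hA : ∀ n ∈ A, 2 ≤ n) (m r : ℕ) :
    |hawkinsY A m ^ r - (Mharm m)⁻¹ ^ r|
      ≤ (r + (r : ℝ) ^ 2) * (Mharm m)⁻¹ ^ (r + 1) * (1 + |dev m A|) ^ (r + 2) := by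
  have h := abs_hawkinsY_pow_sub_expansion_le hA m r
  have hb := inv_Mharm_nonneg m
  have hb1 := inv_Mharm_le_one m
  set b := (Mharm m)⁻¹
  set D := dev m A
  set E := 1 + |D| with hE
  have hE1 : 1 ≤ E := by linarith [abs_nonneg D]
  have h1 : |r * D * b ^ (r + 1)| ≤ r * b ^ (r + 1) * E ^ (r + 2) := by
    rw [abs_mul, abs_mul, abs_of_nonneg (by positivity : (0 : ℝ) ≤ r),
      abs_of_nonneg (by positivity : 0 ≤ b ^ (r + 1))]
    have : |D| ≤ E ^ (r + 2) := (by linarith : |D| ≤ E).trans (le_self_pow₀ hE1 (by omega))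
    calc _ ≤ r * E ^ (r + 2) * b ^ (r + 1) := by gcongr
      _ = _ := by ring
  have h2 : (r : ℝ) ^ 2 * b ^ (r + 2) * E ^ (r + 2) ≤ (r : ℝ) ^ 2 * b ^ (r + 1) * E ^ (r + 2) := by
    have : b ^ (r + 2) ≤ b ^ (r + 1) := pow_le_pow_of_le_one hb hb1 (by omega)
    gcongr
  calc _ = |(hawkinsY A m ^ r - b ^ r + r * D * b ^ (r + 1)) - r * D * b ^ (r + 1)| := by
        congr 1; ring
    _ ≤ _ := abs_sub _ _
    _ ≤ (r : ℝ) ^ 2 * b ^ (r + 1) * E ^ (r + 2) + r * b ^ (r + 1) * E ^ (r + 2) :=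
      add_le_add (h.trans h2) h1
    _ = _ := by ring

end Pointwise

theorem abs_add_pow_sub_expansion_le (D x : ℝ) (hx : |x| ≤ 1) (q : ℕ) :
    |(D + x) ^ (q + 2) - D ^ (q + 2) - ((q : ℝ) + 2) * D ^ (q + 1) * x|
      ≤ ((q : ℝ) + 1) ^ 2 * x ^ 2 * (1 + |D|) ^ q := by
  induction q with
  | zero =>
    rw [show (D + x) ^ (0 + 2) - D ^ (0 + 2) - (((0 : ℕ) : ℝ) + 2) * D ^ (0 + 1) * x = x ^ 2 by
      push_cast; ring, abs_of_nonneg (sq_nonneg x)]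
    simp
  | succ q ih =>
    have hkey : (D + x) ^ (q + 1 + 2) - D ^ (q + 1 + 2) - (((q + 1 : ℕ) : ℝ) + 2) * D ^ (q + 1 + 1) * x
        = (D + x) * ((D + x) ^ (q + 2) - D ^ (q + 2) - ((q : ℝ) + 2) * D ^ (q + 1) * x)
          + ((q : ℝ) + 2) * D ^ (q + 1) * x ^ 2 := by
      push_cast
      ring
    rw [hkey]
    have h1 : |D + x| ≤ 1 + |D| := (abs_add_le _ _).trans (by linarith)
    have h2 : |((q : ℝ) + 2) * D ^ (q + 1) * x ^ 2| ≤ ((q : ℝ) + 2) * x ^ 2 * (1 + |D|) ^ (q + 1) := by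
      rw [abs_mul, abs_mul, abs_of_nonneg (by positivity : (0 : ℝ) ≤ (q : ℝ) + 2), abs_pow,
        abs_of_nonneg (sq_nonneg x)]
      calc _ ≤ ((q : ℝ) + 2) * (1 + |D|) ^ (q + 1) * x ^ 2 := by gcongr; linarith
        _ = _ := by ring
    have h3 : |(D + x) * ((D + x) ^ (q + 2) - D ^ (q + 2) - ((q : ℝ) + 2) * D ^ (q + 1) * x)|
        ≤ (1 + |D|) * (((q : ℝ) + 1) ^ 2 * x ^ 2 * (1 + |D|) ^ q) := by
      rw [abs_mul]
      gcongr
    refine (abs_add_le _ _).trans ((add_le_add h3 h2).trans ?_)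
    have h4 : 0 ≤ x ^ 2 * (1 + |D|) ^ (q + 1) := by positivity
    push_cast
    calc _ = (((q : ℝ) + 1) ^ 2 + (q + 2)) * (x ^ 2 * (1 + |D|) ^ (q + 1)) := by ring
      _ ≤ ((q : ℝ) + 1 + 1) ^ 2 * (x ^ 2 * (1 + |D|) ^ (q + 1)) := by
        gcongr
        nlinarith [show (0 : ℝ) ≤ q by positivity]
      _ = _ := by ring

section Model

variable {Ω : Type*} [MeasurableSpace Ω] {μ : Measure Ω} {α : Ω → Set ℕ}

theorem sieveSigma_le (h : IsHawkinsSieve μ α) (m : ℕ) :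
    sieveSigma α m ≤ (inferInstance : MeasurableSpace Ω) :=
  MeasurableSpace.generateFrom_le fun _ ⟨j, _, _, hs⟩ => hs ▸ h.meas j

theorem DeterminedBelow.exists_eq {m : ℕ} {g : Set ℕ → ℝ} (hg : DeterminedBelow m g) :
    ∃ G : (Fin m → Prop) → ℝ, ∀ A, g A = G fun j => (j : ℕ) ∈ A :=
  ⟨fun p => g {j | ∃ hj : j < m, p ⟨j, hj⟩}, fun A => hg _ _ fun j hj => by simp [hj]⟩

theorem DeterminedBelow.stronglyMeasurable {m : ℕ} {g : Set ℕ → ℝ} (hg : DeterminedBelow m g)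
    (h : IsHawkinsSieve μ α) : StronglyMeasurable[sieveSigma α m] fun ω => g (α ω) := by
  obtain ⟨G, hG⟩ := hg.exists_eq
  have hmeas : Measurable[sieveSigma α m] fun ω => (fun j : Fin m => (j : ℕ) ∈ α ω) := by
    refine @measurable_pi_lambda _ _ _ (sieveSigma α m) _ _ fun j => ?_
    refine (@measurableSet_setOfPred _ (sieveSigma α m) _).1 ?_
    by_cases hj : 2 ≤ (j : ℕ)
    · exact MeasurableSpace.measurableSet_generateFrom ⟨j, hj, j.2, rfl⟩
    · have : {ω | (j : ℕ) ∈ α ω} = ∅ :=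
        Set.eq_empty_of_forall_notMem fun ω hω => hj (h.mem_ge_two ω j hω)
      rw [this]
      exact @MeasurableSet.empty _ (sieveSigma α m)
  simp only [hG]
  exact (Measurable.of_discrete.comp hmeas).stronglyMeasurable

theorem DeterminedBelow.integrable {m : ℕ} {g : Set ℕ → ℝ} (hg : DeterminedBelow m g)
    (h : IsHawkinsSieve μ α) : Integrable (fun ω => g (α ω)) μ := by
  have := h.isProb
  obtain ⟨G, hG⟩ := hg.exists_eq
  obtain ⟨C, hC⟩ := (Set.finite_range fun p => ‖G p‖).bddAbove
  refine Integrable.of_bound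
    ((hg.stronglyMeasurable h).mono (sieveSigma_le h m)).aestronglyMeasurable C (ae_of_all _ fun ω => ?_)
  rw [hG]
  exact hC ⟨_, rfl⟩

/-- The defining property of the sieve, tested against a function of the past. -/
theorem integral_mul_mark (h : IsHawkinsSieve μ α) {m : ℕ} (hm : 2 ≤ m) {g : Set ℕ → ℝ}
    (hg : DeterminedBelow m g) :
    ∫ ω, g (α ω) * mark m (α ω) ∂μ = ∫ ω, g (α ω) * hawkinsY (α ω) m ∂μ := by
  have := h.isProb
  have hind : Set.indicator {ω | m ∈ α ω} (fun _ => (1 : ℝ)) = fun ω => mark m (α ω) := by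
    ext ω
    simp [Set.indicator, mark]
  have hint : Integrable (fun ω => g (α ω) * mark m (α ω)) μ :=
    ((hg.mono m.le_succ).mul (determinedBelow_mark m.lt_succ_self)).integrable h
  have hc := h.condExp_mem m hm
  rw [hind] at hc
  have h1 := condExp_mul_of_stronglyMeasurable_left (μ := μ) (hg.stronglyMeasurable h) hint
    ((determinedBelow_mark m.lt_succ_self).integrable h)
  rw [← integral_condExp (sieveSigma_le h m)]
  refine integral_congr_ae ?_
  filter_upwards [h1, hc] with ω h2 h3
  refine Eq.trans h2 ?_
  simp only [Pi.mul_apply, h3]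

theorem integral_dev (h : IsHawkinsSieve μ α) {m : ℕ} (hm : 2 ≤ m) : ∫ ω, dev m (α ω) ∂μ = 0 := by
  have := h.isProb
  induction m, hm using Nat.le_induction with
  | base =>
    have : ∀ ω, dev 2 (α ω) = 0 := fun ω => by
      rw [dev, hawkinsY_two (h.mem_ge_two ω)]
      simp [Mharm]
    simp [this]
  | succ m hm ih =>
    set t : ℝ := 1 / ((m : ℝ) - 1)
    have hY := determinedBelow_hawkinsY m
    have h1 := integral_mul_mark h hm ((hY.comp fun y => y⁻¹ * t))
    have h2 : ∀ ω, dev (m + 1) (α ω) =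
        (dev m (α ω) - t) + (hawkinsY (α ω) m)⁻¹ * t * mark m (α ω) := fun ω => by
      rw [dev_succ (h.mem_ge_two ω) hm]
      ring
    have h3 : ∀ ω, (hawkinsY (α ω) m)⁻¹ * t * hawkinsY (α ω) m = t := fun ω => by
      have := (hawkinsY_pos (h.mem_ge_two ω) m).ne'
      field_simp
    simp only [h2]
    have hd := (determinedBelow_dev m).integrable h
    rw [integral_add (((determinedBelow_dev m).mono m.le_succ |>.comp fun D => D - t).integrable h)
      ((((hY.comp fun y => y⁻¹ * t).mono m.le_succ).mul
        (determinedBelow_mark m.lt_succ_self)).integrable h), h1]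
    simp only [h3]
    rw [integral_sub hd (integrable_const t), ih]
    simp

theorem integral_dev_pow_succ_le (h : IsHawkinsSieve μ α) {m : ℕ} (hm : 2 ≤ m) (q : ℕ) :
    ∫ ω, dev (m + 1) (α ω) ^ (q + 2) ∂μ ≤ ∫ ω, dev m (α ω) ^ (q + 2)
      + 2 * ((q : ℝ) + 1) ^ 2 * (Mharm m / ((m : ℝ) - 1) ^ 2) * (1 + |dev m (α ω)|) ^ (q + 1) ∂μ := by
  have hm2 : (2 : ℝ) ≤ m := by exact_mod_cast hm
  set t : ℝ := 1 / ((m : ℝ) - 1) with ht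
  have ht0 : 0 < t := by rw [ht]; exact div_pos one_pos (by linarith)
  have hY := determinedBelow_hawkinsY m
  have hD := determinedBelow_dev m
  have hup : DeterminedBelow m fun A => (dev m A + ((hawkinsY A m)⁻¹ - 1) * t) ^ (q + 2) :=
    hD.comp₂ hY fun D y => (D + (y⁻¹ - 1) * t) ^ (q + 2)
  have hdown : DeterminedBelow m fun A => (dev m A - t) ^ (q + 2) :=
    hD.comp fun D => (D - t) ^ (q + 2)
  have hdiff := hup.sub hdown
  have h1 : ∀ ω, dev (m + 1) (α ω) ^ (q + 2) = (dev m (α ω) - t) ^ (q + 2) +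
      ((dev m (α ω) + ((hawkinsY (α ω) m)⁻¹ - 1) * t) ^ (q + 2) - (dev m (α ω) - t) ^ (q + 2))
        * mark m (α ω) := fun ω => by
    rw [dev_succ (h.mem_ge_two ω) hm]
    by_cases hω : m ∈ α ω <;> simp [mark, hω, ht, sub_eq_add_neg]
  simp only [h1]
  rw [integral_add (hdown.integrable h) (((hdiff.mono m.le_succ).mul
    (determinedBelow_mark m.lt_succ_self)).integrable h), integral_mul_mark h hm hdiff,
    ← integral_add (hdown.integrable h) ((hdiff.mul hY).integrable h)]
  refine integral_mono ((hdown.add (hdiff.mul hY)).integrable h)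
    ((hD.comp fun D => D ^ (q + 2) + 2 * ((q : ℝ) + 1) ^ 2 * (Mharm m / ((m : ℝ) - 1) ^ 2) *
      (1 + |D|) ^ (q + 1)).integrable h) fun ω => ?_
  have hA := h.mem_ge_two ω
  have hy0 := hawkinsY_pos hA m
  have hy1 := hawkinsY_le_one hA m
  have hyt := inv_le_hawkinsY hA hm
  rw [← ht] at hyt
  have hz : (hawkinsY (α ω) m)⁻¹ = Mharm m + dev m (α ω) := by unfold dev; ring
  have hM := one_le_Mharm m
  simp only
  set y := hawkinsY (α ω) m
  set D := dev m (α ω)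
  have hyz : y * y⁻¹ = 1 := mul_inv_cancel₀ hy0.ne'
  have hz1 : 1 ≤ y⁻¹ := one_le_inv_iff₀.2 ⟨hy0, hy1⟩
  set z := y⁻¹
  have hzt : z * t ≤ 1 := by
    calc z * t ≤ z * y := by gcongr
      _ = 1 := by rw [mul_comm, hyz]
  have ht1 : t ≤ 1 := by nlinarith
  have e1 := abs_add_pow_sub_expansion_le D ((z - 1) * t) (by rw [abs_le]; constructor <;> nlinarith) q
  have e2 := abs_add_pow_sub_expansion_le D (-t) (by rw [abs_le]; constructor <;> linarith) q
  have e1' := (abs_le.1 e1).2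
  have e2' := (abs_le.1 e2).2
  rw [← sub_eq_add_neg] at e2'
  have hMt : Mharm m / ((m : ℝ) - 1) ^ 2 = Mharm m * t ^ 2 := by
    rw [ht, one_div, inv_pow, div_eq_mul_inv]
  have hzM : z ≤ Mharm m * (1 + |D|) := by
    rw [hz]
    nlinarith [le_abs_self D, abs_nonneg D]
  rw [hMt]
  set P := (1 + |D|) ^ q
  have hP : 0 ≤ P := by positivity
  calc (D - t) ^ (q + 2) + ((D + (z - 1) * t) ^ (q + 2) - (D - t) ^ (q + 2)) * y
      = y * (D + (z - 1) * t) ^ (q + 2) + (1 - y) * (D - t) ^ (q + 2) := by ring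
    _ ≤ y * (D ^ (q + 2) + ((q : ℝ) + 2) * D ^ (q + 1) * ((z - 1) * t)
          + ((q : ℝ) + 1) ^ 2 * ((z - 1) * t) ^ 2 * P)
        + (1 - y) * (D ^ (q + 2) + ((q : ℝ) + 2) * D ^ (q + 1) * (-t)
          + ((q : ℝ) + 1) ^ 2 * (-t) ^ 2 * P) := by
      refine add_le_add (mul_le_mul_of_nonneg_left ?_ hy0.le)
        (mul_le_mul_of_nonneg_left ?_ (by linarith)) <;> linarith
    _ = D ^ (q + 2) + ((q : ℝ) + 1) ^ 2 * t ^ 2 * P * (z - 1) := by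
      linear_combination (((q : ℝ) + 2) * D ^ (q + 1) * t
        + ((q : ℝ) + 1) ^ 2 * t ^ 2 * P * (z - 2)) * hyz
    _ ≤ D ^ (q + 2) + ((q : ℝ) + 1) ^ 2 * t ^ 2 * P * (2 * (Mharm m * (1 + |D|))) := by
      gcongr
      linarith
    _ = _ := by ring

/-- All moments of `1 / y_m - M_m` are bounded. -/
theorem exists_moment_bound (h : IsHawkinsSieve μ α) (q : ℕ) :
    ∃ K : ℝ, 0 < K ∧ ∀ m : ℕ, 2 ≤ m → ∫ ω, (1 + |dev m (α ω)|) ^ q ∂μ ≤ K := by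
  have := h.isProb
  set p := 2 * q + 2 with hp
  set B : ℝ := 2 ^ p with hB
  have hB1 : 1 ≤ B := one_le_pow₀ (by norm_num)
  have hE : ∀ D : ℝ, (1 + |D|) ^ p ≤ B * (1 + D ^ p) := fun D => by
    have heven : Even p := ⟨q + 1, by omega⟩
    have h1 := add_pow_le (zero_le_one' ℝ) (abs_nonneg D) p
    rw [one_pow, heven.pow_abs] at h1
    refine h1.trans (mul_le_mul_of_nonneg_right (pow_le_pow_right₀ (by norm_num) (by omega)) ?_)
    linarith [heven.pow_nonneg D]
  have hint : ∀ m (φ : ℝ → ℝ), Integrable (fun ω => φ (dev m (α ω))) μ := fun m φ =>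
    ((determinedBelow_dev m).comp φ).integrable h
  set u : ℕ → ℝ := fun m => ∫ ω, (1 + dev m (α ω) ^ p) ∂μ with hu
  set c : ℝ := 2 * ((2 * q : ℕ) + 1 : ℝ) ^ 2 * B with hc
  set ε : ℕ → ℝ := fun m => c * (Mharm m / ((m : ℝ) - 1) ^ 2) with hε
  have hε0 : ∀ m, 0 ≤ ε m := fun m => by
    have := (Mharm_pos m).le
    positivity
  have hsum : Summable ε := summable_Mharm_div_sq.mul_left c
  have hu_eq : ∀ m, u m = 1 + ∫ ω, dev m (α ω) ^ p ∂μ := fun m => by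
    simp only [hu]
    rw [integral_add (integrable_const _) (hint m fun D => D ^ p)]
    simp
  have hu0 : ∀ m, 0 ≤ u m := fun m => integral_nonneg fun ω => by
    have : Even p := ⟨q + 1, by omega⟩
    have := this.pow_nonneg (dev m (α ω))
    simp only [Pi.zero_apply]
    linarith
  have hrec : ∀ m, 2 ≤ m → u (m + 1) ≤ u m * Real.exp (ε m) := fun m hm => by
    have h1 := integral_dev_pow_succ_le h hm (2 * q)
    rw [integral_add (hint m fun D => D ^ p) (hint m fun D => _ * (1 + |D|) ^ (2 * q + 1)),
      integral_const_mul] at h1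
    have h2 : ∫ ω, (1 + |dev m (α ω)|) ^ (2 * q + 1) ∂μ ≤ B * u m := by
      simp only [hu]
      rw [← integral_const_mul]
      refine integral_mono (hint m fun D => (1 + |D|) ^ (2 * q + 1))
        (hint m fun D => B * (1 + D ^ p)) fun ω => ?_
      exact (pow_le_pow_right₀ (by linarith [abs_nonneg (dev m (α ω))]) (by omega)).trans (hE _)
    have h3 : 0 ≤ 2 * (((2 * q : ℕ) : ℝ) + 1) ^ 2 * (Mharm m / ((m : ℝ) - 1) ^ 2) := by
      have := (Mharm_pos m).le
      positivity
    have h4 := mul_le_mul_of_nonneg_left h2 h3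
    have h5 : u (m + 1) ≤ u m * (1 + ε m) := by
      rw [hu_eq (m + 1)]
      calc _ ≤ 1 + (∫ ω, dev m (α ω) ^ p ∂μ + 2 * (((2 * q : ℕ) : ℝ) + 1) ^ 2 *
            (Mharm m / ((m : ℝ) - 1) ^ 2) * (B * u m)) := by linarith
        _ = u m + ε m * u m := by rw [← add_assoc, ← hu_eq m, hε, hc]; ring
        _ = _ := by ring
    refine h5.trans (mul_le_mul_of_nonneg_left ?_ (hu0 m))
    linarith [Real.add_one_le_exp (ε m)]
  have hmain : ∀ m, 2 ≤ m → u m ≤ u 2 * Real.exp (∑ j ∈ Finset.range m, ε j) := fun m hm => by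
    induction m, hm using Nat.le_induction with
    | base =>
      exact le_mul_of_one_le_right (hu0 2)
        (Real.one_le_exp (Finset.sum_nonneg fun j _ => hε0 j))
    | succ m hm ih =>
      rw [Finset.sum_range_succ, Real.exp_add, ← mul_assoc]
      exact (hrec m hm).trans (mul_le_mul_of_nonneg_right ih (Real.exp_pos _).le)
  refine ⟨B * (u 2 * Real.exp (∑' j, ε j)) + 1, by have := hu0 2; positivity, fun m hm => ?_⟩
  calc ∫ ω, (1 + |dev m (α ω)|) ^ q ∂μ ≤ ∫ ω, B * (1 + dev m (α ω) ^ p) ∂μ := by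
        refine integral_mono (hint m fun D => (1 + |D|) ^ q)
          (hint m fun D => B * (1 + D ^ p)) fun ω => ?_
        exact (pow_le_pow_right₀ (by linarith [abs_nonneg (dev m (α ω))]) (by omega)).trans (hE _)
    _ = B * u m := integral_const_mul _ _
    _ ≤ B * (u 2 * Real.exp (∑' j, ε j)) := by
      refine mul_le_mul_of_nonneg_left ((hmain m hm).trans ?_) (by linarith)
      refine mul_le_mul_of_nonneg_left (Real.exp_le_exp.2 ?_) (hu0 2)
      exact hsum.sum_le_tsum _ fun j _ => hε0 j
    _ ≤ _ := by linarith

/-- `𝔼 y_m ^ r = M_m ^ (-r) + O(M_m ^ (-r-2))`. -/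
theorem exists_abs_integral_hawkinsY_pow_sub_le (h : IsHawkinsSieve μ α) (r : ℕ) :
    ∃ C : ℝ, 0 < C ∧ ∀ m : ℕ, 2 ≤ m →
      |∫ ω, hawkinsY (α ω) m ^ r ∂μ - (Mharm m)⁻¹ ^ r| ≤ C * (Mharm m)⁻¹ ^ (r + 2) := by
  have := h.isProb
  obtain ⟨K, hK, hKm⟩ := exists_moment_bound h (r + 2)
  refine ⟨(r : ℝ) ^ 2 * K + 1, by positivity, fun m hm => ?_⟩
  have hY := determinedBelow_hawkinsY m
  have hD := determinedBelow_dev m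
  have hb := inv_Mharm_nonneg m
  set b := (Mharm m)⁻¹
  have h1 : ∫ ω, hawkinsY (α ω) m ^ r ∂μ - b ^ r
      = ∫ ω, (hawkinsY (α ω) m ^ r - b ^ r + r * dev m (α ω) * b ^ (r + 1)) ∂μ := by
    rw [integral_add ((hY.comp fun y => y ^ r - b ^ r).integrable h)
      ((hD.comp fun D => r * D * b ^ (r + 1)).integrable h),
      integral_sub ((hY.comp fun y => y ^ r).integrable h) (integrable_const _),
      integral_mul_const, integral_const_mul, integral_dev h hm]
    simp
  rw [h1]
  refine abs_integral_le_integral_abs.trans ?_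
  calc _ ≤ ∫ ω, (r : ℝ) ^ 2 * b ^ (r + 2) * (1 + |dev m (α ω)|) ^ (r + 2) ∂μ :=
        integral_mono ((hY.comp₂ hD fun y D => |y ^ r - b ^ r + r * D * b ^ (r + 1)|).integrable h)
          ((hD.comp fun D => (r : ℝ) ^ 2 * b ^ (r + 2) * (1 + |D|) ^ (r + 2)).integrable h)
          fun ω => abs_hawkinsY_pow_sub_expansion_le (h.mem_ge_two ω) m r
    _ = (r : ℝ) ^ 2 * b ^ (r + 2) * ∫ ω, (1 + |dev m (α ω)|) ^ (r + 2) ∂μ := integral_const_mul _ _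
    _ ≤ (r : ℝ) ^ 2 * b ^ (r + 2) * K := by
      gcongr
      exact hKm m hm
    _ ≤ ((r : ℝ) ^ 2 * K + 1) * b ^ (r + 2) := by
      have : 0 ≤ b ^ (r + 2) := by positivity
      nlinarith

/-- `y_m ^ r` is within `O(M_m ^ (-r-1))` of `M_m ^ (-r)` in `L²`. -/
theorem exists_integral_hawkinsY_pow_sub_sq_le (h : IsHawkinsSieve μ α) (r : ℕ) :
    ∃ C : ℝ, 0 < C ∧ ∀ m : ℕ, 2 ≤ m →
      ∫ ω, (hawkinsY (α ω) m ^ r - (Mharm m)⁻¹ ^ r) ^ 2 ∂μ ≤ C * (Mharm m)⁻¹ ^ (2 * r + 2) := by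
  obtain ⟨K, hK, hKm⟩ := exists_moment_bound h (2 * (r + 2))
  refine ⟨(r + (r : ℝ) ^ 2) ^ 2 * K + 1, by positivity, fun m hm => ?_⟩
  have hY := determinedBelow_hawkinsY m
  have hD := determinedBelow_dev m
  have hb := inv_Mharm_nonneg m
  set b := (Mharm m)⁻¹
  calc _ ≤ ∫ ω, ((r + (r : ℝ) ^ 2) ^ 2 * b ^ (2 * r + 2)) * (1 + |dev m (α ω)|) ^ (2 * (r + 2)) ∂μ := by
        refine integral_mono ((hY.comp fun y => (y ^ r - b ^ r) ^ 2).integrable h)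
          ((hD.comp fun D => ((r + (r : ℝ) ^ 2) ^ 2 * b ^ (2 * r + 2)) *
            (1 + |D|) ^ (2 * (r + 2))).integrable h) fun ω => ?_
        have h1 := pow_le_pow_left₀ (abs_nonneg _)
          (abs_hawkinsY_pow_sub_le (h.mem_ge_two ω) m r) 2
        rw [sq_abs] at h1
        refine h1.trans (le_of_eq ?_)
        ring
    _ = ((r + (r : ℝ) ^ 2) ^ 2 * b ^ (2 * r + 2)) * ∫ ω, (1 + |dev m (α ω)|) ^ (2 * (r + 2)) ∂μ :=
      integral_const_mul _ _
    _ ≤ ((r + (r : ℝ) ^ 2) ^ 2 * b ^ (2 * r + 2)) * K := by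
      gcongr
      exact hKm m hm
    _ ≤ _ := by
      have : 0 ≤ b ^ (2 * r + 2) := by positivity
      nlinarith


/-- `x` or `1 - x`, according to whether `p` holds. -/
noncomputable def pick (p : Prop) (x : ℝ) : ℝ := if p then x else 1 - x

theorem pick_nonneg {p : Prop} {x : ℝ} (h0 : 0 ≤ x) (h1 : x ≤ 1) : 0 ≤ pick p x := by
  unfold pick; split_ifs <;> linarith

theorem pick_le_one {p : Prop} {x : ℝ} (h0 : 0 ≤ x) (h1 : x ≤ 1) : pick p x ≤ 1 := by
  unfold pick; split_ifs <;> linarith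

theorem abs_pick_sub_pick (p : Prop) (x y : ℝ) : |pick p x - pick p y| = |x - y| := by
  unfold pick
  split_ifs
  · rfl
  · rw [show 1 - x - (1 - y) = -(x - y) by ring, abs_neg]

/-- The indicator that, for all `h < N`, `m + h ∈ A` holds exactly when `P h` does. -/
noncomputable def patInd (P : ℕ → Prop) (N m : ℕ) (A : Set ℕ) : ℝ :=
  ∏ h ∈ Finset.range N, pick (P h) (mark (m + h) A)

theorem patInd_nonneg (P : ℕ → Prop) (N m : ℕ) (A : Set ℕ) : 0 ≤ patInd P N m A :=
  Finset.prod_nonneg fun _ _ => pick_nonneg (mark_nonneg _ _) (mark_le_one _ _)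

theorem patInd_le_one (P : ℕ → Prop) (N m : ℕ) (A : Set ℕ) : patInd P N m A ≤ 1 :=
  Finset.prod_le_one (fun _ _ => pick_nonneg (mark_nonneg _ _) (mark_le_one _ _))
    fun _ _ => pick_le_one (mark_nonneg _ _) (mark_le_one _ _)

theorem determinedBelow_patInd (P : ℕ → Prop) (N m : ℕ) : DeterminedBelow (m + N) (patInd P N m) :=
  DeterminedBelow.prod fun h hh =>
    (determinedBelow_mark (by have := Finset.mem_range.1 hh; omega)).comp (pick (P h))

theorem patInd_eq_ite (P : ℕ → Prop) (N m : ℕ) (A : Set ℕ) :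
    patInd P N m A = if ∀ h < N, (m + h ∈ A ↔ P h) then 1 else 0 := by
  split_ifs with hall
  · refine Finset.prod_eq_one fun h hh => ?_
    have := hall h (Finset.mem_range.1 hh)
    by_cases hP : P h <;> simp [pick, mark, this, hP]
  · push Not at hall
    obtain ⟨h, hh, hne⟩ := hall
    refine Finset.prod_eq_zero (Finset.mem_range.2 hh) ?_
    rcases hne with ⟨h1, h2⟩ | ⟨h1, h2⟩ <;> simp [pick, mark, h1, h2]

theorem integral_mul_pick_mark (h : IsHawkinsSieve μ α) {m : ℕ} (hm : 2 ≤ m) {g : Set ℕ → ℝ}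
    (hg : DeterminedBelow m g) (p : Prop) :
    ∫ ω, g (α ω) * pick p (mark m (α ω)) ∂μ = ∫ ω, g (α ω) * pick p (hawkinsY (α ω) m) ∂μ := by
  by_cases hp : p
  · simpa only [pick, if_pos hp] using integral_mul_mark h hm hg
  · simp only [pick, if_neg hp, mul_sub, mul_one]
    rw [integral_sub (hg.integrable h) (((hg.mono m.le_succ).mul
      (determinedBelow_mark m.lt_succ_self)).integrable h), integral_mul_mark h hm hg,
      integral_sub (hg.integrable h) ((hg.mul (determinedBelow_hawkinsY m)).integrable h)]

theorem abs_integral_le_of_abs_le [IsProbabilityMeasure μ] {f : Ω → ℝ} {c : ℝ}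
    (hf : ∀ ω, |f ω| ≤ c) : |∫ ω, f ω ∂μ| ≤ c := by
  simpa using norm_integral_le_of_norm_le_const (μ := μ) (f := f) (C := c) (ae_of_all _ hf)

/-- Given the past, a pattern at `m` behaves like independent marks of density `y_m`, up to
`O(1 / m)`. -/
theorem abs_integral_mul_patInd_sub_le (h : IsHawkinsSieve μ α) (P : ℕ → Prop) (N : ℕ) {m : ℕ}
    (hm : 2 ≤ m) {g : Set ℕ → ℝ} (hg : DeterminedBelow m g) {c : ℝ} (hc : ∀ ω, |g (α ω)| ≤ c) :
    |∫ ω, g (α ω) * patInd P N m (α ω) ∂μ -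
      ∫ ω, g (α ω) * ∏ t ∈ Finset.range N, pick (P t) (hawkinsY (α ω) m) ∂μ|
      ≤ c * (N : ℝ) ^ 2 * (1 / m) := by
  have := h.isProb
  have hY := determinedBelow_hawkinsY m
  induction N generalizing g with
  | zero => simp [patInd]
  | succ N ih =>
    obtain ⟨ω₀⟩ : Nonempty Ω := nonempty_of_isProbabilityMeasure μ
    have hc0 : 0 ≤ c := (abs_nonneg _).trans (hc ω₀)
    have hY01 : ∀ ω n, 0 ≤ hawkinsY (α ω) n ∧ hawkinsY (α ω) n ≤ 1 := fun ω n =>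
      ⟨(hawkinsY_pos (h.mem_ge_two ω) n).le, hawkinsY_le_one (h.mem_ge_two ω) n⟩
    have hg' : DeterminedBelow m fun A => g A * pick (P N) (hawkinsY A m) :=
      hg.mul (hY.comp (pick (P N)))
    have h1 := ih hg' fun ω => by
      rw [abs_mul, abs_of_nonneg (pick_nonneg (hY01 ω m).1 (hY01 ω m).2)]
      exact (mul_le_of_le_one_right (abs_nonneg _)
        (pick_le_one (hY01 ω m).1 (hY01 ω m).2)).trans (hc ω)
    have hgp : DeterminedBelow (m + N) fun A => g A * patInd P N m A :=
      (hg.mono (Nat.le_add_right m N)).mul (determinedBelow_patInd P N m)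
    have h2 := integral_mul_pick_mark h (by omega : 2 ≤ m + N) hgp (P N)
    have h3 : |∫ ω, g (α ω) * patInd P N m (α ω) * pick (P N) (hawkinsY (α ω) (m + N)) ∂μ
        - ∫ ω, g (α ω) * patInd P N m (α ω) * pick (P N) (hawkinsY (α ω) m) ∂μ|
        ≤ c * (N * (1 / m)) := by
      rw [← integral_sub ((hgp.mul ((determinedBelow_hawkinsY (m + N)).comp
        (pick (P N)))).integrable h) ((hgp.mul ((hY.comp (pick (P N))).mono
        (Nat.le_add_right m N))).integrable h)]
      refine abs_integral_le_of_abs_le fun ω => ?_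
      rw [← mul_sub, abs_mul, abs_mul, abs_pick_sub_pick,
        abs_of_nonneg (patInd_nonneg P N m (α ω))]
      have hb := hawkinsY_add_bounds (h.mem_ge_two ω) (by omega : 1 ≤ m) N
      have hd : |hawkinsY (α ω) (m + N) - hawkinsY (α ω) m| ≤ N * (1 / m) := by
        rw [abs_le, mul_one_div]
        have : (0 : ℝ) ≤ N / m := by positivity
        constructor <;> linarith [hb.1, hb.2]
      refine mul_le_mul ?_ hd (abs_nonneg _) hc0
      exact (mul_le_of_le_one_right (abs_nonneg _) (patInd_le_one P N m (α ω))).trans (hc ω)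
    have e1 : ∀ ω, g (α ω) * patInd P (N + 1) m (α ω)
        = g (α ω) * patInd P N m (α ω) * pick (P N) (mark (m + N) (α ω)) := fun ω => by
      rw [patInd, Finset.prod_range_succ, ← patInd, mul_assoc]
    have e2 : ∀ ω, g (α ω) * ∏ t ∈ Finset.range (N + 1), pick (P t) (hawkinsY (α ω) m)
        = g (α ω) * pick (P N) (hawkinsY (α ω) m) *
          ∏ t ∈ Finset.range N, pick (P t) (hawkinsY (α ω) m) := fun ω => by
      rw [Finset.prod_range_succ]
      ring
    have e3 : ∀ ω, g (α ω) * patInd P N m (α ω) * pick (P N) (hawkinsY (α ω) m)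
        = g (α ω) * pick (P N) (hawkinsY (α ω) m) * patInd P N m (α ω) := fun ω => by ring
    simp only [e1, e2, e3] at h2 h3 ⊢
    rw [h2]
    refine (abs_sub_le _ _ _).trans ((add_le_add h3 h1).trans ?_)
    have : (0 : ℝ) ≤ c * (1 / m) := by positivity
    push_cast
    nlinarith [show (0 : ℝ) ≤ N by positivity]

theorem inv_le_inv_Mharm_pow (r : ℕ) :
    ∃ C : ℝ, 0 < C ∧ ∀ n : ℕ, 1 ≤ n → 1 / (n : ℝ) ≤ C * (Mharm n)⁻¹ ^ r := by
  obtain ⟨C, hC, h⟩ := one_le_mul_inv_Mharm_pow r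
  refine ⟨C, hC, fun n hn => ?_⟩
  have hn0 : (0 : ℝ) < n := by exact_mod_cast hn
  rw [div_le_iff₀ hn0]
  linarith [h n hn]

theorem Mharm_of_lt_two {m : ℕ} (hm : m < 2) : Mharm m = 1 := by
  rw [Mharm, show m - 2 = 0 by omega]
  simp

theorem abs_one_sub_pow_sub_le {y : ℝ} (h0 : 0 ≤ y) (h1 : y ≤ 1) (b : ℕ) :
    |(1 - y) ^ b - 1| ≤ b * y ∧ |(1 - y) ^ b - (1 - b * y)| ≤ (b : ℝ) ^ 2 * y ^ 2 := by
  induction b with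
  | zero => simp
  | succ b ih =>
    have e1 : (1 - y) ^ (b + 1) - 1 = (1 - y) * ((1 - y) ^ b - 1) + -y := by ring
    have e2 : (1 - y) ^ (b + 1) - (1 - ((b + 1 : ℕ) : ℝ) * y)
        = (1 - y) * ((1 - y) ^ b - (1 - b * y)) + b * y ^ 2 := by push_cast; ring
    have h2 : |1 - y| ≤ 1 := by rw [abs_le]; constructor <;> linarith
    rw [e1, e2]
    constructor
    · refine (abs_add_le _ _).trans ?_
      rw [abs_mul, abs_neg, abs_of_nonneg h0]
      have := mul_le_mul h2 ih.1 (abs_nonneg _) zero_le_one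
      push_cast
      linarith
    · refine (abs_add_le _ _).trans ?_
      rw [abs_mul, abs_of_nonneg (by positivity : 0 ≤ (b : ℝ) * y ^ 2)]
      have h3 := mul_le_mul h2 ih.2 (abs_nonneg _) zero_le_one
      have h4 : 0 ≤ (b : ℝ) * y ^ 2 := by positivity
      push_cast
      nlinarith [sq_nonneg y]

theorem exists_integral_density_sub_sq_le (h : IsHawkinsSieve μ α) (a b : ℕ) : ∃ C : ℝ, 0 < C ∧ ∀ m : ℕ,
    ∫ ω, (hawkinsY (α ω) m ^ a * (1 - hawkinsY (α ω) m) ^ b - (Mharm m)⁻¹ ^ a) ^ 2 ∂μ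
      ≤ C * (Mharm m)⁻¹ ^ (2 * a + 2) := by
  have := h.isProb
  obtain ⟨C₁, hC₁, h₁⟩ := exists_integral_hawkinsY_pow_sub_sq_le h a
  obtain ⟨C₂, hC₂, h₂⟩ := exists_abs_integral_hawkinsY_pow_sub_le h (2 * a + 2)
  refine ⟨2 * C₁ + 2 * (b : ℝ) ^ 2 * (1 + C₂) + 1, by positivity, fun m => ?_⟩
  rcases lt_or_ge m 2 with hm | hm
  · rw [Mharm_of_lt_two hm]
    simp only [inv_one, one_pow, mul_one]
    refine ((le_abs_self _).trans (abs_integral_le_of_abs_le (c := 1) fun ω => ?_)).trans (by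
      have : 0 ≤ 2 * C₁ + 2 * (b : ℝ) ^ 2 * (1 + C₂) := by positivity
      linarith)
    have hA := h.mem_ge_two ω
    have hy := (hawkinsY_pos hA m).le
    have hy1 := hawkinsY_le_one hA m
    have h1 : hawkinsY (α ω) m ^ a * (1 - hawkinsY (α ω) m) ^ b ≤ 1 :=
      mul_le_one₀ (pow_le_one₀ hy hy1) (pow_nonneg (by linarith) _)
        (pow_le_one₀ (by linarith) (by linarith))
    have h2 : 0 ≤ hawkinsY (α ω) m ^ a * (1 - hawkinsY (α ω) m) ^ b :=
      mul_nonneg (pow_nonneg hy _) (pow_nonneg (by linarith) _)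
    rw [abs_pow]
    refine pow_le_one₀ (abs_nonneg _) ?_
    rw [abs_le]
    constructor <;> linarith
  · have hb := inv_Mharm_nonneg m
    have hb1 := inv_Mharm_le_one m
    have e₁ := h₁ m hm
    have e₂ := (abs_le.1 (h₂ m hm)).2
    set β := (Mharm m)⁻¹
    have hint : ∀ φ : ℝ → ℝ, Integrable (fun ω => φ (hawkinsY (α ω) m)) μ := fun φ =>
      ((determinedBelow_hawkinsY m).comp φ).integrable h
    have e₃ : ∫ ω, (hawkinsY (α ω) m ^ a * (1 - hawkinsY (α ω) m) ^ b - β ^ a) ^ 2 ∂μ ≤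
        2 * ∫ ω, (hawkinsY (α ω) m ^ a - β ^ a) ^ 2 ∂μ +
          2 * (b : ℝ) ^ 2 * ∫ ω, hawkinsY (α ω) m ^ (2 * a + 2) ∂μ := by
      rw [← integral_const_mul, ← integral_const_mul,
        ← integral_add (hint fun y => 2 * (y ^ a - β ^ a) ^ 2)
          (hint fun y => 2 * (b : ℝ) ^ 2 * y ^ (2 * a + 2))]
      refine integral_mono (hint fun y => (y ^ a * (1 - y) ^ b - β ^ a) ^ 2)
        (hint fun y => 2 * (y ^ a - β ^ a) ^ 2 + 2 * (b : ℝ) ^ 2 * y ^ (2 * a + 2)) fun ω => ?_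
      have hA := h.mem_ge_two ω
      have hy := (hawkinsY_pos hA m).le
      have hq := (abs_one_sub_pow_sub_le hy (hawkinsY_le_one hA m) b).1
      simp only
      set y := hawkinsY (α ω) m
      have hq2 := pow_le_pow_left₀ (abs_nonneg _) hq 2
      rw [sq_abs] at hq2
      calc _ = ((y ^ a - β ^ a) + y ^ a * ((1 - y) ^ b - 1)) ^ 2 := by ring
        _ ≤ 2 * ((y ^ a - β ^ a) ^ 2 + (y ^ a * ((1 - y) ^ b - 1)) ^ 2) := add_sq_le
        _ = 2 * (y ^ a - β ^ a) ^ 2 + 2 * ((y ^ a) ^ 2 * ((1 - y) ^ b - 1) ^ 2) := by ring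
        _ ≤ 2 * (y ^ a - β ^ a) ^ 2 + 2 * ((y ^ a) ^ 2 * (b * y) ^ 2) := by gcongr
        _ = _ := by ring
    have e₂' : ∫ ω, hawkinsY (α ω) m ^ (2 * a + 2) ∂μ ≤ (1 + C₂) * β ^ (2 * a + 2) := by
      have : β ^ (2 * a + 2 + 2) ≤ β ^ (2 * a + 2) := pow_le_pow_of_le_one hb hb1 (by omega)
      nlinarith
    have e₄ := mul_le_mul_of_nonneg_left e₂' (by positivity : 0 ≤ 2 * (b : ℝ) ^ 2)
    have : 0 ≤ β ^ (2 * a + 2) := by positivity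
    nlinarith

/-- Second moment and mean of `y_{n+1} ^ a` about its approximate mean. -/
theorem exists_moments_hawkinsY_succ_pow (h : IsHawkinsSieve μ α) (a : ℕ) : ∃ C : ℝ, 0 < C ∧
    ∀ n : ℕ, 2 ≤ n →
      |∫ ω, hawkinsY (α ω) (n + 1) ^ a ∂μ - (Mharm n)⁻¹ ^ a| ≤ C * (Mharm n)⁻¹ ^ (a + 2) ∧
      ∫ ω, (hawkinsY (α ω) (n + 1) ^ a - (Mharm n)⁻¹ ^ a) ^ 2 ∂μ
        ≤ C * (Mharm n)⁻¹ ^ (2 * a + 2) := by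
  have := h.isProb
  obtain ⟨C₁, hC₁, h₁⟩ := exists_abs_integral_hawkinsY_pow_sub_le h a
  obtain ⟨C₂, hC₂, h₂⟩ := exists_integral_hawkinsY_pow_sub_sq_le h a
  obtain ⟨C₃, hC₃, h₃⟩ := inv_le_inv_Mharm_pow (a + 2)
  set D : ℝ := ((a : ℝ) + (a : ℝ) ^ 2 * 2 ^ a) * (2 * C₃) with hD
  have hD0 : 0 ≤ D := by positivity
  refine ⟨(C₁ + D) + (2 * C₂ + 2 * D ^ 2), by positivity, fun n hn => ?_⟩
  have hb := inv_Mharm_nonneg n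
  have hb1 := inv_Mharm_le_one n
  have hb' := inv_Mharm_nonneg (n + 1)
  have hmono := inv_Mharm_succ_le hn
  have hn2 : (2 : ℝ) ≤ n := by exact_mod_cast hn
  have e₁ := h₁ (n + 1) (by omega)
  have e₂ := h₂ (n + 1) (by omega)
  have e₃ : |(Mharm (n + 1))⁻¹ ^ a - (Mharm n)⁻¹ ^ a| ≤ D * (Mharm n)⁻¹ ^ (a + 2) := by
    refine (abs_inv_Mharm_pow_sub_succ_le hn a).trans ?_
    have h4 : 1 / ((n : ℝ) - 1) ≤ 2 * (1 / n) := by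
      rw [mul_one_div, div_le_div_iff₀ (by linarith) (by linarith)]
      linarith
    calc _ ≤ ((a : ℝ) + (a : ℝ) ^ 2 * 2 ^ a) * (2 * (C₃ * (Mharm n)⁻¹ ^ (a + 2))) := by
          gcongr
          exact h4.trans (by have := h₃ n (by omega); linarith)
      _ = _ := by rw [hD]; ring
  have hsucc : ∀ r : ℕ, (Mharm (n + 1))⁻¹ ^ r ≤ (Mharm n)⁻¹ ^ r := fun r =>
    pow_le_pow_left₀ hb' hmono r
  have p₁ := hsucc (a + 2)
  have p₂ := hsucc (2 * a + 2)
  set β := (Mharm n)⁻¹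
  set β' := (Mharm (n + 1))⁻¹
  have hint : ∀ φ : ℝ → ℝ, Integrable (fun ω => φ (hawkinsY (α ω) (n + 1))) μ := fun φ =>
    ((determinedBelow_hawkinsY (n + 1)).comp φ).integrable h
  constructor
  · refine (abs_sub_le _ (β' ^ a) _).trans ((add_le_add e₁ e₃).trans ?_)
    have : 0 ≤ β ^ (a + 2) := by positivity
    have : 0 ≤ (2 * C₂ + 2 * D ^ 2) * β ^ (a + 2) := by positivity
    nlinarith
  · have e₄ : ∫ ω, (hawkinsY (α ω) (n + 1) ^ a - β ^ a) ^ 2 ∂μ ≤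
        2 * ∫ ω, (hawkinsY (α ω) (n + 1) ^ a - β' ^ a) ^ 2 ∂μ + 2 * (β' ^ a - β ^ a) ^ 2 := by
      have h5 : ∫ ω, (2 * (hawkinsY (α ω) (n + 1) ^ a - β' ^ a) ^ 2 +
          2 * (β' ^ a - β ^ a) ^ 2) ∂μ = _ :=
        integral_add (hint fun y => 2 * (y ^ a - β' ^ a) ^ 2) (integrable_const _)
      rw [integral_const_mul, integral_const, probReal_univ, one_smul] at h5
      rw [← h5]
      refine integral_mono (hint fun y => (y ^ a - β ^ a) ^ 2)
        (hint fun y => 2 * (y ^ a - β' ^ a) ^ 2 + 2 * (β' ^ a - β ^ a) ^ 2) fun ω => ?_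
      simp only
      nlinarith [sq_nonneg (hawkinsY (α ω) (n + 1) ^ a - β' ^ a - (β' ^ a - β ^ a))]
    have e₅ : (β' ^ a - β ^ a) ^ 2 ≤ D ^ 2 * β ^ (2 * a + 2) := by
      calc _ = |β' ^ a - β ^ a| ^ 2 := (sq_abs _).symm
        _ ≤ (D * β ^ (a + 2)) ^ 2 := by gcongr
        _ = D ^ 2 * β ^ (2 * a + 4) := by ring
        _ ≤ _ := by
          gcongr ?_ * ?_
          exact pow_le_pow_of_le_one hb hb1 (by omega)
    have : 0 ≤ (C₁ + D) * β ^ (2 * a + 2) := by positivity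
    nlinarith

/-- The mean of a product is close to `x * t` when the factors are close to `x` and `t` in mean and
in mean square. -/
theorem abs_integral_mul_sub_le [IsProbabilityMeasure μ] {X T : Ω → ℝ} {x t n : ℝ} (hn : 0 < n)
    (hX : Integrable X μ) (hT : Integrable T μ) (hXT : Integrable (fun ω => X ω * T ω) μ)
    (hX2 : Integrable (fun ω => (X ω - x) ^ 2) μ) (hT2 : Integrable (fun ω => (T ω - t) ^ 2) μ) :
    |∫ ω, X ω * T ω ∂μ - x * t| ≤ n * ∫ ω, (X ω - x) ^ 2 ∂μ + n⁻¹ * ∫ ω, (T ω - t) ^ 2 ∂μ +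
      |x| * |∫ ω, T ω ∂μ - t| + |t| * |∫ ω, X ω ∂μ - x| := by
  have hi : Integrable (fun ω => x * (T ω - t)) μ := (hT.sub (integrable_const t)).const_mul x
  have hj : Integrable (fun ω => t * (X ω - x)) μ := (hX.sub (integrable_const x)).const_mul t
  have hij : Integrable (fun ω => x * (T ω - t) + t * (X ω - x)) μ := hi.add hj
  have hc : Integrable (fun ω => X ω * T ω - x * t) μ := hXT.sub (integrable_const _)
  have hd : Integrable (fun ω => (X ω - x) * (T ω - t)) μ :=
    (hc.sub hij).congr (ae_of_all _ fun ω => by simp only [Pi.sub_apply]; ring)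
  have e : ∫ ω, X ω * T ω ∂μ - x * t = ∫ ω, (X ω - x) * (T ω - t) ∂μ +
      (x * (∫ ω, T ω ∂μ - t) + t * (∫ ω, X ω ∂μ - x)) := by
    have k₁ : ∫ ω, (T ω - t) ∂μ = ∫ ω, T ω ∂μ - t := by
      rw [integral_sub hT (integrable_const t)]; simp
    have k₂ : ∫ ω, (X ω - x) ∂μ = ∫ ω, X ω ∂μ - x := by
      rw [integral_sub hX (integrable_const x)]; simp
    have k₃ : ∫ ω, (X ω * T ω - x * t) ∂μ = ∫ ω, X ω * T ω ∂μ - x * t := by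
      rw [integral_sub hXT (integrable_const _)]; simp
    rw [← k₁, ← k₂, ← k₃, ← integral_const_mul, ← integral_const_mul, ← integral_add hi hj,
      ← integral_add hd hij]
    congr 1
    ext ω
    ring
  have e₁ : |∫ ω, (X ω - x) * (T ω - t) ∂μ| ≤
      n * ∫ ω, (X ω - x) ^ 2 ∂μ + n⁻¹ * ∫ ω, (T ω - t) ^ 2 ∂μ := by
    rw [← integral_const_mul, ← integral_const_mul,
      ← integral_add (hX2.const_mul n) (hT2.const_mul n⁻¹)]
    refine abs_integral_le_integral_abs.trans (integral_mono hd.abs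
      ((hX2.const_mul n).add (hT2.const_mul n⁻¹)) fun ω => ?_)
    have hsq : n * (X ω - x) ^ 2 + n⁻¹ * (T ω - t) ^ 2 - 2 * |(X ω - x) * (T ω - t)| =
        n * (|X ω - x| - n⁻¹ * |T ω - t|) ^ 2 := by
      rw [abs_mul, ← sq_abs (X ω - x), ← sq_abs (T ω - t)]
      field_simp
      ring
    have : 0 ≤ n * (|X ω - x| - n⁻¹ * |T ω - t|) ^ 2 := by positivity
    have := abs_nonneg ((X ω - x) * (T ω - t))
    linarith
  rw [e]
  refine (abs_add_le _ _).trans ?_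
  have e₂ := abs_add_le (x * (∫ ω, T ω ∂μ - t)) (t * (∫ ω, X ω ∂μ - x))
  rw [abs_mul, abs_mul] at e₂
  linarith

theorem abs_add_mul_le (c : ℝ) (a : ℕ) {n β : ℝ} (hn : 0 ≤ n) (hb : 0 ≤ β)
    (hb1 : β ≤ 1) :
    |n * β ^ a + c * (n * β ^ (a + 1))| ≤ (1 + |c|) * (n * β ^ a) := by
  refine (abs_add_le _ _).trans ?_
  rw [abs_mul c, abs_of_nonneg (by positivity : 0 ≤ n * β ^ a),
    abs_of_nonneg (by positivity : 0 ≤ n * β ^ (a + 1)), add_mul, one_mul]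
  have := mul_le_mul_of_nonneg_left (pow_le_pow_of_le_one hb hb1 a.le_succ) hn
  gcongr

section Pattern

variable {P : ℕ → Prop} {N a b : ℕ}

/-- The number of occurrences of the pattern `P` up to `n`. -/
noncomputable def patCount (P : ℕ → Prop) (N n : ℕ) (A : Set ℕ) : ℝ :=
  ∑ m ∈ Finset.range (n + 1), patInd P N m A

theorem determinedBelow_patCount (P : ℕ → Prop) (N n : ℕ) :
    DeterminedBelow (n + N + 1) (patCount P N n) :=
  DeterminedBelow.sum fun m hm => (determinedBelow_patInd P N m).mono (by
    have := Finset.mem_range.1 hm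
    omega)

theorem exists_abs_integral_patInd_sub_le
    (hPN : ∀ y : ℝ, ∏ t ∈ Finset.range N, pick (P t) y = y ^ a * (1 - y) ^ b)
    (h : IsHawkinsSieve μ α) : ∃ C : ℝ, 0 < C ∧ ∀ m : ℕ,
    |∫ ω, patInd P N m (α ω) ∂μ - ((Mharm m)⁻¹ ^ a - b * (Mharm m)⁻¹ ^ (a + 1))|
      ≤ C * (Mharm m)⁻¹ ^ (a + 2) := by
  have := h.isProb
  obtain ⟨C₁, hC₁, h₁⟩ := inv_le_inv_Mharm_pow (a + 2)
  obtain ⟨C₂, hC₂, h₂⟩ := exists_abs_integral_hawkinsY_pow_sub_le h a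
  obtain ⟨C₃, hC₃, h₃⟩ := exists_abs_integral_hawkinsY_pow_sub_le h (a + 1)
  obtain ⟨C₄, hC₄, h₄⟩ := exists_abs_integral_hawkinsY_pow_sub_le h (a + 2)
  refine ⟨(N : ℝ) ^ 2 * C₁ + (b : ℝ) ^ 2 * (1 + C₄) + C₂ + b * C₃ + (2 + b), by positivity,
    fun m => ?_⟩
  rcases lt_or_ge m 2 with hm | hm
  · rw [Mharm_of_lt_two hm]
    simp only [inv_one, one_pow, mul_one]
    have h5 : |∫ ω, patInd P N m (α ω) ∂μ| ≤ 1 := abs_integral_le_of_abs_le fun ω => by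
      rw [abs_of_nonneg (patInd_nonneg _ _ _ _)]
      exact patInd_le_one _ _ _ _
    have h6 : |(1 : ℝ) - b| ≤ 1 + b := by
      rw [abs_le]; constructor <;> linarith [show (0 : ℝ) ≤ b by positivity]
    refine (abs_sub _ _).trans ?_
    have : 0 ≤ (N : ℝ) ^ 2 * C₁ + (b : ℝ) ^ 2 * (1 + C₄) + C₂ + b * C₃ := by positivity
    linarith
  · have hY := determinedBelow_hawkinsY m
    have hb := inv_Mharm_nonneg m
    have hb1 := inv_Mharm_le_one m
    have e₁ := abs_integral_mul_patInd_sub_le h P N hm (DeterminedBelow.const 1) (c := 1)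
      (fun _ => by simp)
    simp only [one_mul, hPN] at e₁
    have e₁' := e₁.trans (mul_le_mul_of_nonneg_left (h₁ m (by omega)) (by positivity))
    have e₂ := h₂ m hm
    have e₃ := h₃ m hm
    have e₄ := h₄ m hm
    set β := (Mharm m)⁻¹
    have hint : ∀ φ : ℝ → ℝ, Integrable (fun ω => φ (hawkinsY (α ω) m)) μ := fun φ =>
      (hY.comp φ).integrable h
    have e₅ : |∫ ω, hawkinsY (α ω) m ^ a * (1 - hawkinsY (α ω) m) ^ b ∂μ
        - (∫ ω, hawkinsY (α ω) m ^ a ∂μ - b * ∫ ω, hawkinsY (α ω) m ^ (a + 1) ∂μ)|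
        ≤ (b : ℝ) ^ 2 * ∫ ω, hawkinsY (α ω) m ^ (a + 2) ∂μ := by
      rw [← integral_const_mul, ← integral_const_mul, ← integral_sub (hint fun y => y ^ a)
        (hint fun y => b * y ^ (a + 1)), ← integral_sub (hint fun y => y ^ a * (1 - y) ^ b)
        (hint fun y => y ^ a - b * y ^ (a + 1))]
      refine abs_integral_le_integral_abs.trans (integral_mono
        (hint fun y => |y ^ a * (1 - y) ^ b - (y ^ a - b * y ^ (a + 1))|)
        (hint fun y => (b : ℝ) ^ 2 * y ^ (a + 2)) fun ω => ?_)
      have hA := h.mem_ge_two ω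
      have hy := (hawkinsY_pos hA m).le
      have hq := (abs_one_sub_pow_sub_le hy (hawkinsY_le_one hA m) b).2
      simp only
      set y := hawkinsY (α ω) m
      calc _ = |y ^ a * ((1 - y) ^ b - (1 - b * y))| := by congr 1; ring
        _ = y ^ a * |(1 - y) ^ b - (1 - b * y)| := by rw [abs_mul, abs_of_nonneg (by positivity)]
        _ ≤ y ^ a * ((b : ℝ) ^ 2 * y ^ 2) := by gcongr
        _ = _ := by ring
    have e₄' : ∫ ω, hawkinsY (α ω) m ^ (a + 2) ∂μ ≤ (1 + C₄) * β ^ (a + 2) := by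
      have : β ^ (a + 2 + 2) ≤ β ^ (a + 2) := pow_le_pow_of_le_one hb hb1 (by omega)
      have := (abs_le.1 e₄).2
      nlinarith
    have e₃' : |b * (∫ ω, hawkinsY (α ω) m ^ (a + 1) ∂μ - β ^ (a + 1))| ≤ b * (C₃ * β ^ (a + 2)) := by
      rw [abs_mul, abs_of_nonneg (by positivity : (0 : ℝ) ≤ b)]
      have : β ^ (a + 1 + 2) ≤ β ^ (a + 2) := pow_le_pow_of_le_one hb hb1 (by omega)
      exact mul_le_mul_of_nonneg_left (e₃.trans (by gcongr)) (by positivity)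
    have e₅' := e₅.trans (mul_le_mul_of_nonneg_left e₄' (by positivity))
    have hβ : 0 ≤ β ^ (a + 2) := by positivity
    have hslack : 0 ≤ (2 + (b : ℝ)) * β ^ (a + 2) := by positivity
    rw [abs_le] at *
    constructor <;> nlinarith [e₁'.1, e₁'.2, e₂.1, e₂.2, e₃'.1, e₃'.2, e₅'.1, e₅'.2]

/-- The mean of the number of occurrences of a pattern. -/
theorem exists_abs_integral_patCount_sub_le
    (hPN : ∀ y : ℝ, ∏ t ∈ Finset.range N, pick (P t) y = y ^ a * (1 - y) ^ b)
    (h : IsHawkinsSieve μ α) : ∃ C : ℝ, 0 < C ∧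
    ∀ n : ℕ, 2 ≤ n → |∫ ω, patCount P N n (α ω) ∂μ -
      (n * (Mharm n)⁻¹ ^ a + ((a : ℝ) - b) * (n * (Mharm n)⁻¹ ^ (a + 1)))|
        ≤ C * (n * (Mharm n)⁻¹ ^ (a + 2)) := by
  obtain ⟨C₁, hC₁, h₁⟩ := exists_abs_integral_patInd_sub_le hPN h
  obtain ⟨C₂, hC₂, h₂⟩ := sumInvMharm_le (a + 2)
  obtain ⟨C₃, hC₃, h₃⟩ := abs_sumInvMharm_sub_le a
  obtain ⟨C₄, hC₄, h₄⟩ := abs_sumInvMharm_sub_le (a + 1)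
  set δ : ℝ := |(a : ℝ) - b| with hδ
  refine ⟨C₁ * C₂ + C₃ + δ * (C₄ + (a + 1) * C₂), by positivity, fun n hn => ?_⟩
  have hsum : ∫ ω, patCount P N n (α ω) ∂μ
      = ∑ m ∈ Finset.range (n + 1), ∫ ω, patInd P N m (α ω) ∂μ :=
    integral_finsetSum _ fun m _ => (determinedBelow_patInd P N m).integrable h
  have e₁ : |∫ ω, patCount P N n (α ω) ∂μ - (sumInvMharm a n - b * sumInvMharm (a + 1) n)|
      ≤ C₁ * sumInvMharm (a + 2) n := by
    rw [hsum, sumInvMharm, sumInvMharm, sumInvMharm, Finset.mul_sum, Finset.mul_sum,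
      ← Finset.sum_sub_distrib, ← Finset.sum_sub_distrib]
    exact (Finset.abs_sum_le_sum_abs _ _).trans (Finset.sum_le_sum fun m _ => h₁ m)
  have e₂ := h₂ n hn
  have e₃ := h₃ n hn
  have e₄ := h₄ n hn
  have hβ' : (n : ℝ) * (Mharm n)⁻¹ ^ (a + 1 + 2) ≤ n * (Mharm n)⁻¹ ^ (a + 2) :=
    mul_le_mul_of_nonneg_left
      (pow_le_pow_of_le_one (inv_Mharm_nonneg n) (inv_Mharm_le_one n) (by omega)) (by positivity)
  have hS : 0 ≤ sumInvMharm (a + 2) n :=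
    Finset.sum_nonneg fun m _ => pow_nonneg (inv_Mharm_nonneg m) _
  set X := (n : ℝ) * (Mharm n)⁻¹ ^ (a + 2)
  have e₅ : |((a : ℝ) - b) * (sumInvMharm (a + 1) n - n * (Mharm n)⁻¹ ^ (a + 1))|
      ≤ δ * ((C₄ + (a + 1) * C₂) * X) := by
    rw [abs_mul, ← hδ]
    refine mul_le_mul_of_nonneg_left ?_ (abs_nonneg _)
    have h5 : ((a : ℝ) + 1) * sumInvMharm (a + 1 + 1) n ≤ (a + 1) * (C₂ * X) := by gcongr
    have h6 : 0 ≤ ((a : ℝ) + 1) * sumInvMharm (a + 1 + 1) n := by positivity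
    push_cast at e₄
    rw [abs_le] at e₄ ⊢
    constructor <;> nlinarith [e₄.1, e₄.2]
  have e₁' := e₁.trans (mul_le_mul_of_nonneg_left e₂ hC₁.le)
  rw [abs_le] at *
  constructor <;> nlinarith [e₁'.1, e₁'.2, e₃.1, e₃.2, e₅.1, e₅.2]

/-- The fluctuations of `Σ_{m < n} (1_{pattern at m} - y_m ^ a (1 - y_m) ^ b)` are `O(√n)`. -/
theorem exists_integral_sum_resid_sq_le
    (hPN : ∀ y : ℝ, ∏ t ∈ Finset.range N, pick (P t) y = y ^ a * (1 - y) ^ b)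
    (h : IsHawkinsSieve μ α) : ∃ C : ℝ, 0 < C ∧ ∀ n : ℕ,
    ∫ ω, (∑ m ∈ Finset.range n,
      (patInd P N m (α ω) - hawkinsY (α ω) m ^ a * (1 - hawkinsY (α ω) m) ^ b)) ^ 2 ∂μ ≤ C * n := by
  have := h.isProb
  set U : ℕ → Set ℕ → ℝ := fun m A => patInd P N m A - hawkinsY A m ^ a * (1 - hawkinsY A m) ^ b
    with hU
  have hUdet : ∀ m, DeterminedBelow (m + N) (U m) := fun m =>
    (determinedBelow_patInd P N m).sub
      (((determinedBelow_hawkinsY m).comp fun y => y ^ a * (1 - y) ^ b).mono (Nat.le_add_right m N))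
  have hUle : ∀ m ω, |U m (α ω)| ≤ 1 := fun m ω => by
    have hA := h.mem_ge_two ω
    have hy := (hawkinsY_pos hA m).le
    have hy1 := hawkinsY_le_one hA m
    have h1 : hawkinsY (α ω) m ^ a * (1 - hawkinsY (α ω) m) ^ b ≤ 1 :=
      mul_le_one₀ (pow_le_one₀ hy hy1) (pow_nonneg (by linarith) _)
        (pow_le_one₀ (by linarith) (by linarith))
    have h2 : 0 ≤ hawkinsY (α ω) m ^ a * (1 - hawkinsY (α ω) m) ^ b :=
      mul_nonneg (pow_nonneg hy _) (pow_nonneg (by linarith) _)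
    rw [abs_le]
    constructor <;> simp only [hU] <;> linarith [patInd_nonneg P N m (α ω), patInd_le_one P N m (α ω)]
  have hSle : ∀ (s : Finset ℕ) ω, |∑ m ∈ s, U m (α ω)| ≤ s.card := fun s ω => by
    refine (Finset.abs_sum_le_sum_abs _ _).trans ((Finset.sum_le_sum fun m _ => hUle m ω).trans ?_)
    simp
  have hSdet : ∀ n, DeterminedBelow (n + N) fun A => ∑ m ∈ Finset.range n, U m A := fun n =>
    DeterminedBelow.sum fun m hm => (hUdet m).mono (by have := Finset.mem_range.1 hm; omega)
  refine ⟨2 * (N : ℝ) ^ 2 + 2 * N + 5, by positivity, fun n => ?_⟩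
  change ∫ ω, (∑ m ∈ Finset.range n, U m (α ω)) ^ 2 ∂μ ≤ _
  induction n with
  | zero => simp
  | succ n ih =>
    have hcross : ∫ ω, (∑ m ∈ Finset.range n, U m (α ω)) * U n (α ω) ∂μ ≤ (N : ℝ) ^ 2 + N + 2 := by
      rcases lt_or_ge n 2 with hn | hn
      · refine (le_abs_self _).trans (abs_integral_le_of_abs_le fun ω => ?_)
        rw [abs_mul]
        have h1 := hSle (Finset.range n) ω
        rw [Finset.card_range] at h1
        have h2 : (n : ℝ) ≤ 2 := by exact_mod_cast hn.le
        have h3 := mul_le_mul (h1.trans h2) (hUle n ω) (abs_nonneg _) (by norm_num)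
        have : 0 ≤ (N : ℝ) ^ 2 + N := by positivity
        linarith
      · have hn0 : (0 : ℝ) < n := by exact_mod_cast (by omega : 0 < n)
        have hpast : DeterminedBelow n fun A => ∑ m ∈ Finset.range (n - N), U m A :=
          DeterminedBelow.sum fun m hm => (hUdet m).mono (by have := Finset.mem_range.1 hm; omega)
        have hpb : ∀ ω, |∑ m ∈ Finset.range (n - N), U m (α ω)| ≤ n := fun ω => by
          refine (hSle _ ω).trans ?_
          rw [Finset.card_range]
          exact_mod_cast Nat.sub_le n N
        have h1 := abs_integral_mul_patInd_sub_le h P N hn hpast hpb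
        simp only [hPN] at h1
        rw [← integral_sub ((hpast.mono (Nat.le_add_right n N)).mul
          (determinedBelow_patInd P N n) |>.integrable h) ((hpast.mul
          ((determinedBelow_hawkinsY n).comp fun y => y ^ a * (1 - y) ^ b)).integrable h)] at h1
        have h2 : (n : ℝ) * (N : ℝ) ^ 2 * (1 / n) = (N : ℝ) ^ 2 := by field_simp
        rw [h2] at h1
        simp only [← mul_sub] at h1
        have hrest : DeterminedBelow (n + N) fun A => ∑ m ∈ Finset.Ico (n - N) n, U m A :=
          DeterminedBelow.sum fun m hm => (hUdet m).mono (by have := (Finset.mem_Ico.1 hm).2; omega)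
        have h3 : |∫ ω, (∑ m ∈ Finset.Ico (n - N) n, U m (α ω)) * U n (α ω) ∂μ| ≤ N := by
          refine abs_integral_le_of_abs_le fun ω => ?_
          rw [abs_mul]
          have h4 := hSle (Finset.Ico (n - N) n) ω
          rw [Nat.card_Ico] at h4
          have h5 : ((n - (n - N) : ℕ) : ℝ) ≤ N := by exact_mod_cast (by omega)
          calc _ ≤ (N : ℝ) * 1 := mul_le_mul (h4.trans h5) (hUle n ω) (abs_nonneg _) (by positivity)
            _ = N := mul_one _
        have hsplit : ∀ ω, (∑ m ∈ Finset.range n, U m (α ω)) * U n (α ω) =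
            (∑ m ∈ Finset.range (n - N), U m (α ω)) * U n (α ω) +
              (∑ m ∈ Finset.Ico (n - N) n, U m (α ω)) * U n (α ω) := fun ω => by
          rw [← add_mul, Finset.sum_range_add_sum_Ico _ (Nat.sub_le n N)]
        simp only [hsplit]
        rw [integral_add (((hpast.mono (Nat.le_add_right n N)).mul (hUdet n)).integrable h)
          ((hrest.mul (hUdet n)).integrable h)]
        linarith [(abs_le.1 h1).2, (abs_le.1 h3).2]
    have hsq : |∫ ω, U n (α ω) ^ 2 ∂μ| ≤ 1 := abs_integral_le_of_abs_le fun ω => by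
      rw [abs_pow]
      exact pow_le_one₀ (abs_nonneg _) (hUle n ω)
    have hexp : ∀ ω, (∑ m ∈ Finset.range (n + 1), U m (α ω)) ^ 2 =
        (∑ m ∈ Finset.range n, U m (α ω)) ^ 2 +
          2 * ((∑ m ∈ Finset.range n, U m (α ω)) * U n (α ω)) + U n (α ω) ^ 2 := fun ω => by
      rw [Finset.sum_range_succ]
      ring
    simp only [hexp]
    have i1 := ((hSdet n).comp fun x => x ^ 2).integrable h
    have i2 := (((hSdet n).mul (hUdet n)).comp fun x => 2 * x).integrable h
    have i3 := ((hUdet n).comp fun x => x ^ 2).integrable h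
    have i12 : Integrable (fun ω => (∑ m ∈ Finset.range n, U m (α ω)) ^ 2 +
        2 * ((∑ m ∈ Finset.range n, U m (α ω)) * U n (α ω))) μ := i1.add i2
    rw [integral_add i12 i3, integral_add i1 i2, integral_const_mul]
    push_cast
    linarith [(abs_le.1 hsq).2]

/-- The second moment of the number of occurrences of a pattern about its approximate mean. -/
theorem exists_integral_patCount_sub_sq_le
    (hPN : ∀ y : ℝ, ∏ t ∈ Finset.range N, pick (P t) y = y ^ a * (1 - y) ^ b)
    (h : IsHawkinsSieve μ α) : ∃ C : ℝ, 0 < C ∧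
    ∀ n : ℕ, 2 ≤ n → ∫ ω, (patCount P N n (α ω) -
      (n * (Mharm n)⁻¹ ^ a + ((a : ℝ) - b) * (n * (Mharm n)⁻¹ ^ (a + 1)))) ^ 2 ∂μ
        ≤ C * ((n : ℝ) ^ 2 * (Mharm n)⁻¹ ^ (2 * a + 2)) := by
  have := h.isProb
  obtain ⟨C₁, hC₁, h₁⟩ := exists_integral_sum_resid_sq_le hPN h
  obtain ⟨C₂, hC₂, h₂⟩ := exists_integral_density_sub_sq_le h a b
  obtain ⟨C₃, hC₃, h₃⟩ := sumInvMharm_le (2 * a + 2)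
  obtain ⟨C₄, hC₄, h₄⟩ := abs_sumInvMharm_sub_le a
  obtain ⟨C₅, hC₅, h₅⟩ := sumInvMharm_le (a + 1)
  obtain ⟨C₆, hC₆, h₆⟩ := one_le_mul_inv_Mharm_pow (2 * a + 2)
  set δ : ℝ := |(a : ℝ) - b| with hδ
  refine ⟨3 * (2 * C₁ * C₆ + 2 * C₂ * C₃ + (C₄ + a * C₅ + δ) ^ 2), by positivity, fun n hn => ?_⟩
  have hn1 : (1 : ℝ) ≤ n := by exact_mod_cast (by omega : 1 ≤ n)
  have hb := inv_Mharm_nonneg n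
  have hb1 := inv_Mharm_le_one n
  set β := (Mharm n)⁻¹ with hβ
  set V : Set ℕ → ℝ := fun A => ∑ m ∈ Finset.range (n + 1),
    (patInd P N m A - hawkinsY A m ^ a * (1 - hawkinsY A m) ^ b) with hV
  set W : ℕ → Set ℕ → ℝ := fun m A => hawkinsY A m ^ a * (1 - hawkinsY A m) ^ b - (Mharm m)⁻¹ ^ a
    with hW
  set κ : ℝ := sumInvMharm a n - (n * β ^ a + ((a : ℝ) - b) * (n * β ^ (a + 1))) with hκ
  have hVdet : DeterminedBelow (n + 1 + N) V := DeterminedBelow.sum fun m hm => by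
    have := Finset.mem_range.1 hm
    exact ((determinedBelow_patInd P N m).mono (by omega)).sub
      (((determinedBelow_hawkinsY m).comp fun y => y ^ a * (1 - y) ^ b).mono (by omega))
  have hWdet : ∀ m ∈ Finset.range (n + 1), DeterminedBelow (n + 1 + N) (W m) := fun m hm => by
    have := Finset.mem_range.1 hm
    exact ((determinedBelow_hawkinsY m).comp
      fun y => y ^ a * (1 - y) ^ b - (Mharm m)⁻¹ ^ a).mono (by omega)
  have hdecomp : ∀ A, patCount P N n A - (n * β ^ a + ((a : ℝ) - b) * (n * β ^ (a + 1)))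
      = V A + ∑ m ∈ Finset.range (n + 1), W m A + κ := fun A => by
    simp only [hV, hW, hκ, patCount, sumInvMharm, Finset.sum_sub_distrib]
    ring
  have hpt : ∀ A, (V A + ∑ m ∈ Finset.range (n + 1), W m A + κ) ^ 2
      ≤ 3 * (V A ^ 2 + ((n : ℝ) + 1) * ∑ m ∈ Finset.range (n + 1), W m A ^ 2 + κ ^ 2) := fun A => by
    have h7 := sq_sum_le_card_mul_sum_sq (s := Finset.range (n + 1)) (f := fun m => W m A)
    rw [Finset.card_range] at h7
    push_cast at h7
    set w := ∑ m ∈ Finset.range (n + 1), W m A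
    nlinarith [sq_nonneg (V A - w), sq_nonneg (V A - κ), sq_nonneg (w - κ)]
  have hint₁ : Integrable (fun ω => V (α ω) ^ 2) μ := (hVdet.comp fun x => x ^ 2).integrable h
  have hWsq : ∀ m ∈ Finset.range (n + 1), DeterminedBelow (n + 1 + N) fun A => W m A ^ 2 :=
    fun m hm => (hWdet m hm).comp fun x => x ^ 2
  have hint₂ : Integrable (fun ω => ((n : ℝ) + 1) * ∑ m ∈ Finset.range (n + 1), W m (α ω) ^ 2) μ :=
    ((DeterminedBelow.sum hWsq).comp fun x => ((n : ℝ) + 1) * x).integrable h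
  have hint₁₂ : Integrable (fun ω => V (α ω) ^ 2 +
      ((n : ℝ) + 1) * ∑ m ∈ Finset.range (n + 1), W m (α ω) ^ 2) μ := hint₁.add hint₂
  have hle : ∫ ω, (V (α ω) + ∑ m ∈ Finset.range (n + 1), W m (α ω) + κ) ^ 2 ∂μ ≤
      3 * (∫ ω, V (α ω) ^ 2 ∂μ +
        ((n : ℝ) + 1) * ∑ m ∈ Finset.range (n + 1), ∫ ω, W m (α ω) ^ 2 ∂μ + κ ^ 2) := by
    have hint₁₂₃ : Integrable (fun ω => V (α ω) ^ 2 +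
        ((n : ℝ) + 1) * ∑ m ∈ Finset.range (n + 1), W m (α ω) ^ 2 + κ ^ 2) μ :=
      hint₁₂.add (integrable_const _)
    refine (integral_mono ((((hVdet.add (DeterminedBelow.sum hWdet)).comp
      fun x => (x + κ) ^ 2)).integrable h) (hint₁₂₃.const_mul 3)
      fun ω => hpt (α ω)).trans (le_of_eq ?_)
    rw [integral_const_mul, integral_add hint₁₂ (integrable_const _),
      integral_add hint₁ hint₂, integral_const_mul,
      integral_finsetSum _ fun m hm => (hWsq m hm).integrable h]
    simp
  have hn2 : (n : ℝ) + 1 ≤ 2 * n := by linarith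
  have hX : 0 ≤ (n : ℝ) ^ 2 * β ^ (2 * a + 2) := by positivity
  have b₁ : ∫ ω, V (α ω) ^ 2 ∂μ ≤ 2 * C₁ * C₆ * ((n : ℝ) ^ 2 * β ^ (2 * a + 2)) := by
    have h7 := h₁ (n + 1)
    push_cast at h7
    have h8 := h₆ n (by omega)
    calc _ ≤ C₁ * ((n : ℝ) + 1) := h7
      _ ≤ C₁ * (2 * n) := by gcongr
      _ = C₁ * (2 * n) * 1 := (mul_one _).symm
      _ ≤ C₁ * (2 * n) * (C₆ * (n * β ^ (2 * a + 2))) := by gcongr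
      _ = _ := by ring
  have b₂ : ((n : ℝ) + 1) * ∑ m ∈ Finset.range (n + 1), ∫ ω, W m (α ω) ^ 2 ∂μ
      ≤ 2 * C₂ * C₃ * ((n : ℝ) ^ 2 * β ^ (2 * a + 2)) := by
    have h7 : ∑ m ∈ Finset.range (n + 1), ∫ ω, W m (α ω) ^ 2 ∂μ ≤ C₂ * sumInvMharm (2 * a + 2) n := by
      rw [sumInvMharm, Finset.mul_sum]
      exact Finset.sum_le_sum fun m _ => h₂ m
    have h8 := h₃ n hn
    calc _ ≤ ((n : ℝ) + 1) * (C₂ * (C₃ * (n * β ^ (2 * a + 2)))) := by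
          gcongr
          exact h7.trans (by gcongr)
      _ ≤ (2 * n) * (C₂ * (C₃ * (n * β ^ (2 * a + 2)))) := by gcongr
      _ = _ := by ring
  have b₃ : κ ^ 2 ≤ (C₄ + a * C₅ + δ) ^ 2 * ((n : ℝ) ^ 2 * β ^ (2 * a + 2)) := by
    have h7 := h₄ n hn
    have h8 : (a : ℝ) * sumInvMharm (a + 1) n ≤ a * (C₅ * (n * β ^ (a + 1))) := by
      gcongr
      exact h₅ n hn
    have h9 : 0 ≤ (a : ℝ) * sumInvMharm (a + 1) n :=
      mul_nonneg (by positivity) (Finset.sum_nonneg fun m _ => pow_nonneg (inv_Mharm_nonneg m) _)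
    have h10 : (n : ℝ) * β ^ (a + 2) ≤ n * β ^ (a + 1) :=
      mul_le_mul_of_nonneg_left (pow_le_pow_of_le_one hb hb1 (by omega)) (by positivity)
    have h11 : |((a : ℝ) - b) * (n * β ^ (a + 1))| ≤ δ * (n * β ^ (a + 1)) := by
      rw [abs_mul, ← hδ, abs_of_nonneg (by positivity : 0 ≤ (n : ℝ) * β ^ (a + 1))]
    have h12 : |κ| ≤ (C₄ + a * C₅ + δ) * (n * β ^ (a + 1)) := by
      rw [abs_le] at *
      constructor <;> nlinarith [h7.1, h7.2, h11.1, h11.2]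
    calc κ ^ 2 = |κ| ^ 2 := (sq_abs κ).symm
      _ ≤ ((C₄ + a * C₅ + δ) * (n * β ^ (a + 1))) ^ 2 := by gcongr
      _ = _ := by ring
  simp only [hdecomp]
  refine hle.trans ?_
  linarith



theorem exists_abs_integral_mul_patCount_sub_le
    (hPN : ∀ y : ℝ, ∏ t ∈ Finset.range N, pick (P t) y = y ^ a * (1 - y) ^ b)
    (h : IsHawkinsSieve μ α) : ∃ C : ℝ, ∀ n : ℕ,
    2 ≤ n → |∫ ω, hawkinsY (α ω) (n + 1) ^ a * patCount P N n (α ω) ∂μ -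
      (n * (Mharm n)⁻¹ ^ (2 * a) + ((a : ℝ) - b) * (n * (Mharm n)⁻¹ ^ (2 * a + 1)))|
        ≤ C * (n * (Mharm n)⁻¹ ^ (2 * a + 2)) := by
  have := h.isProb
  obtain ⟨C₁, hC₁, h₁⟩ := exists_moments_hawkinsY_succ_pow h a
  obtain ⟨C₂, hC₂, h₂⟩ := exists_abs_integral_patCount_sub_le hPN h
  obtain ⟨C₃, hC₃, h₃⟩ := exists_integral_patCount_sub_sq_le hPN h
  refine ⟨C₁ + C₃ + C₂ + (1 + |(a : ℝ) - b|) * C₁, fun n hn => ?_⟩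
  have hn0 : (0 : ℝ) < n := by exact_mod_cast (by omega : 0 < n)
  have hb := inv_Mharm_nonneg n
  obtain ⟨e₁, e₂⟩ := h₁ n hn
  have e₃ := h₂ n hn
  have e₄ := h₃ n hn
  have e₅ := abs_add_mul_le ((a : ℝ) - b) a hn0.le hb (inv_Mharm_le_one n)
  set β := (Mharm n)⁻¹
  set t := n * β ^ a + ((a : ℝ) - b) * (n * β ^ (a + 1)) with ht
  have hX := determinedBelow_hawkinsY (n + 1)
  have hT := determinedBelow_patCount P N n
  have e := abs_integral_mul_sub_le (μ := μ) (x := β ^ a) (t := t) hn0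
    ((hX.comp fun y => y ^ a).integrable h) (hT.integrable h)
    ((((hX.comp fun y => y ^ a).mono (by omega : n + 1 ≤ n + N + 1)).mul hT).integrable h)
    ((hX.comp fun y => (y ^ a - β ^ a) ^ 2).integrable h)
    ((hT.comp fun y => (y - t) ^ 2).integrable h)
  have et : β ^ a * t = n * β ^ (2 * a) + ((a : ℝ) - b) * (n * β ^ (2 * a + 1)) := by
    rw [ht]; ring
  rw [et] at e
  refine e.trans ?_
  have f₁ : (n : ℝ)⁻¹ * (C₃ * ((n : ℝ) ^ 2 * β ^ (2 * a + 2)))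
      = C₃ * (n * β ^ (2 * a + 2)) := by field_simp
  rw [abs_of_nonneg (by positivity : 0 ≤ β ^ a)]
  calc _ ≤ n * (C₁ * β ^ (2 * a + 2)) + (n : ℝ)⁻¹ * (C₃ * ((n : ℝ) ^ 2 * β ^ (2 * a + 2))) +
        β ^ a * (C₂ * (n * β ^ (a + 2))) +
        (1 + |(a : ℝ) - b|) * (n * β ^ a) * (C₁ * β ^ (a + 2)) := by gcongr
    _ = _ := by rw [f₁]; ring

theorem exists_abs_integral_patCount_sq_sub_le
    (hPN : ∀ y : ℝ, ∏ t ∈ Finset.range N, pick (P t) y = y ^ a * (1 - y) ^ b)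
    (h : IsHawkinsSieve μ α) : ∃ C : ℝ, ∀ n : ℕ,
    2 ≤ n → |∫ ω, patCount P N n (α ω) ^ 2 ∂μ - ((n : ℝ) ^ 2 * (Mharm n)⁻¹ ^ (2 * a) +
      2 * ((a : ℝ) - b) * ((n : ℝ) ^ 2 * (Mharm n)⁻¹ ^ (2 * a + 1)))|
        ≤ C * ((n : ℝ) ^ 2 * (Mharm n)⁻¹ ^ (2 * a + 2)) := by
  have := h.isProb
  obtain ⟨C₂, hC₂, h₂⟩ := exists_abs_integral_patCount_sub_le hPN h
  obtain ⟨C₃, hC₃, h₃⟩ := exists_integral_patCount_sub_sq_le hPN h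
  refine ⟨C₃ + C₃ + (1 + |(a : ℝ) - b|) * C₂ + (1 + |(a : ℝ) - b|) * C₂ + ((a : ℝ) - b) ^ 2,
    fun n hn => ?_⟩
  have hn0 : (0 : ℝ) < n := by exact_mod_cast (by omega : 0 < n)
  have hb := inv_Mharm_nonneg n
  have e₃ := h₂ n hn
  have e₄ := h₃ n hn
  have e₅ := abs_add_mul_le ((a : ℝ) - b) a hn0.le hb (inv_Mharm_le_one n)
  set β := (Mharm n)⁻¹
  set t := n * β ^ a + ((a : ℝ) - b) * (n * β ^ (a + 1)) with ht
  have hT := determinedBelow_patCount P N n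
  have hTT : Integrable (fun ω => patCount P N n (α ω) * patCount P N n (α ω)) μ :=
    (hT.mul hT).integrable h
  have hTs := (hT.comp fun y => (y - t) ^ 2).integrable h
  have e := abs_integral_mul_sub_le (μ := μ) (x := t) (t := t) one_pos (hT.integrable h)
    (hT.integrable h) hTT hTs hTs
  simp only [← sq] at e
  have et : t ^ 2 = ((n : ℝ) ^ 2 * β ^ (2 * a) +
      2 * ((a : ℝ) - b) * ((n : ℝ) ^ 2 * β ^ (2 * a + 1))) +
      ((a : ℝ) - b) ^ 2 * ((n : ℝ) ^ 2 * β ^ (2 * a + 2)) := by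
    rw [ht]; ring
  have f : |t| * |∫ ω, patCount P N n (α ω) ∂μ - t|
      ≤ (1 + |(a : ℝ) - b|) * C₂ * ((n : ℝ) ^ 2 * β ^ (2 * a + 2)) := by
    calc _ ≤ (1 + |(a : ℝ) - b|) * (n * β ^ a) * (C₂ * (n * β ^ (a + 2))) := by gcongr
      _ = _ := by ring
  have g : 0 ≤ ((a : ℝ) - b) ^ 2 * ((n : ℝ) ^ 2 * β ^ (2 * a + 2)) := by positivity
  rw [abs_le] at e ⊢
  constructor <;> nlinarith [e.1, e.2]

theorem exists_abs_variance_patCount_le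
    (hPN : ∀ y : ℝ, ∏ t ∈ Finset.range N, pick (P t) y = y ^ a * (1 - y) ^ b)
    (h : IsHawkinsSieve μ α) : ∃ C : ℝ, ∀ n : ℕ,
    2 ≤ n → |∫ ω, patCount P N n (α ω) ^ 2 ∂μ - (∫ ω, patCount P N n (α ω) ∂μ) ^ 2|
        ≤ C * ((n : ℝ) ^ 2 * (Mharm n)⁻¹ ^ (2 * a + 2)) := by
  have := h.isProb
  obtain ⟨C₂, hC₂, h₂⟩ := exists_abs_integral_patCount_sub_le hPN h
  obtain ⟨C₃, hC₃, h₃⟩ := exists_integral_patCount_sub_sq_le hPN h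
  refine ⟨C₃ + C₂ ^ 2, fun n hn => ?_⟩
  have hb := inv_Mharm_nonneg n
  have e₃ := h₂ n hn
  have e₄ := h₃ n hn
  have hb1 := inv_Mharm_le_one n
  set β := (Mharm n)⁻¹
  set t := n * β ^ a + ((a : ℝ) - b) * (n * β ^ (a + 1)) with ht
  have hT := determinedBelow_patCount P N n
  have h5 : Integrable (fun ω => 2 * t * patCount P N n (α ω) - t ^ 2) μ :=
    (hT.comp fun y => 2 * t * y - t ^ 2).integrable h
  have e : ∫ ω, patCount P N n (α ω) ^ 2 ∂μ = ∫ ω, (patCount P N n (α ω) - t) ^ 2 ∂μ +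
      (2 * t * ∫ ω, patCount P N n (α ω) ∂μ - t ^ 2) := by
    have h6 : ∫ ω, (2 * t * patCount P N n (α ω) - t ^ 2) ∂μ =
        2 * t * ∫ ω, patCount P N n (α ω) ∂μ - t ^ 2 := by
      rw [integral_sub ((hT.integrable h).const_mul _) (integrable_const _), integral_const_mul]
      simp
    rw [← h6, ← integral_add ((hT.comp fun y => (y - t) ^ 2).integrable h) h5]
    congr 1
    ext ω
    ring
  have f : (∫ ω, patCount P N n (α ω) ∂μ - t) ^ 2
      ≤ C₂ ^ 2 * ((n : ℝ) ^ 2 * β ^ (2 * a + 2)) := by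
    calc _ = |∫ ω, patCount P N n (α ω) ∂μ - t| ^ 2 := (sq_abs _).symm
      _ ≤ (C₂ * (n * β ^ (a + 2))) ^ 2 := by gcongr
      _ = C₂ ^ 2 * ((n : ℝ) ^ 2 * β ^ (2 * a + 4)) := by ring
      _ ≤ _ := by
        gcongr ?_ * (?_ * ?_)
        exact pow_le_pow_of_le_one hb hb1 (by omega)
  have g : 0 ≤ ∫ ω, (patCount P N n (α ω) - t) ^ 2 ∂μ := integral_nonneg fun ω => sq_nonneg _
  have k : 0 ≤ C₂ ^ 2 * ((n : ℝ) ^ 2 * β ^ (2 * a + 2)) := by positivity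
  have k' : 0 ≤ C₃ * ((n : ℝ) ^ 2 * β ^ (2 * a + 2)) := by positivity
  have hs := sq_nonneg (∫ ω, patCount P N n (α ω) ∂μ - t)
  rw [e, abs_le]
  constructor <;> nlinarith

end Pattern

end Model

theorem prod_pick_eq {N : ℕ} {P : ℕ → Prop} [DecidablePred P] {a b : ℕ}
    (ha : ((Finset.range N).filter P).card = a) (hab : a + b = N) (y : ℝ) :
    ∏ t ∈ Finset.range N, pick (P t) y = y ^ a * (1 - y) ^ b := by
  have hcard := Finset.card_filter_add_card_filter_not (s := Finset.range N) P
  rw [Finset.card_range] at hcard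
  have hpick : ∀ t, pick (P t) y = if P t then y else 1 - y := fun t => by
    unfold pick
    split_ifs <;> rfl
  simp only [hpick]
  rw [Finset.prod_ite, Finset.prod_const, Finset.prod_const, ha,
    show ((Finset.range N).filter fun t => ¬P t).card = b by omega]

theorem lt_of_lt_of_forall_lt_succ {l : ℕ} {i : ℕ → ℕ} (hmono : ∀ j : ℕ, j ≤ l → i j < i (j + 1))
    {s t : ℕ} (hst : s < t) (ht : t ≤ l + 1) : i s < i t := by
  induction t, hst using Nat.le_induction with
  | base => exact hmono s (by omega)
  | succ t hst ih => exact (ih (by omega)).trans (hmono t (by omega))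

theorem card_filter_range_exists_eq {l k : ℕ} {i : ℕ → ℕ} (hlast : i (l + 1) = k)
    (hmono : ∀ j : ℕ, j ≤ l → i j < i (j + 1)) :
    ((Finset.range (k + 1)).filter fun t => ∃ j : ℕ, j ≤ l + 1 ∧ i j = t).card = l + 2 := by
  have himg : ((Finset.range (k + 1)).filter fun t => ∃ j : ℕ, j ≤ l + 1 ∧ i j = t)
      = (Finset.range (l + 2)).image i := by
    ext t
    simp only [Finset.mem_filter, Finset.mem_range, Finset.mem_image]
    constructor
    · rintro ⟨-, j, hj, rfl⟩
      exact ⟨j, by omega, rfl⟩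
    · rintro ⟨j, hj, rfl⟩
      refine ⟨?_, j, by omega, rfl⟩
      rcases eq_or_lt_of_le (by omega : j ≤ l + 1) with rfl | hj'
      · omega
      · have := lt_of_lt_of_forall_lt_succ hmono hj' le_rfl
        omega
  rw [himg, Finset.card_image_of_injOn, Finset.card_range]
  intro s hs t ht hst
  simp only [Finset.coe_range, Set.mem_Iio] at hs ht
  rcases lt_trichotomy s t with hlt | heq | hgt
  · have := lt_of_lt_of_forall_lt_succ hmono hlt (by omega)
    omega
  · exact heq
  · have := lt_of_lt_of_forall_lt_succ hmono hgt (by omega)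
    omega

theorem cast_hawkinsT (A : Set ℕ) (l k : ℕ) (i : ℕ → ℕ) (n : ℕ) :
    (hawkinsT A l k i n : ℝ) = patCount (fun t => ∃ j : ℕ, j ≤ l + 1 ∧ i j = t) (k + 1) n A := by
  rw [hawkinsT, Finset.card_filter]
  push_cast
  refine Finset.sum_congr rfl fun m _ => ?_
  rw [patInd_eq_ite]
  simp only [patMem, Nat.lt_succ_iff]
  congr

theorem isBigO_of_abs_le {f g : ℕ → ℝ} {C : ℝ} (hfg : ∀ n, 2 ≤ n → |f n| ≤ C * g n)
    (hg : ∀ n, 0 ≤ g n) : f =O[atTop] g :=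
  IsBigO.of_bound C <| (eventually_ge_atTop 2).mono fun n hn => by
    rw [Real.norm_eq_abs, Real.norm_of_nonneg (hg n)]
    exact hfg n hn

theorem hawkinsT_second_moment_and_variance (l k : ℕ) (i : ℕ → ℕ) (h0 : i 0 = 0)
    (hlast : i (l + 1) = k) (hmono : ∀ j : ℕ, j ≤ l → i j < i (j + 1))
    {Ω : Type*} [MeasurableSpace Ω] (μ : Measure Ω) (α : Ω → Set ℕ)
    (h : IsHawkinsSieve μ α) :
    ((fun n : ℕ =>
        (∫ ω, (hawkinsY (α ω) (n + 1)) ^ (l + 2) * (hawkinsT (α ω) l k i n : ℝ) ∂μ) -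
          ((n : ℝ) / (Mharm n) ^ (2 * l + 4) -
            ((k : ℝ) - 2 * l - 3) * (n : ℝ) / (Mharm n) ^ (2 * l + 5)))
      =O[atTop] fun n : ℕ => (n : ℝ) / (Mharm n) ^ (2 * l + 6)) ∧
    ((fun n : ℕ =>
        (∫ ω, ((hawkinsT (α ω) l k i n : ℝ)) ^ 2 ∂μ) -
          ((n : ℝ) ^ 2 / (Mharm n) ^ (2 * l + 4) -
            (2 * (k : ℝ) - 4 * l - 6) * (n : ℝ) ^ 2 / (Mharm n) ^ (2 * l + 5)))
      =O[atTop] fun n : ℕ => (n : ℝ) ^ 2 / (Mharm n) ^ (2 * l + 6)) ∧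
    ((fun n : ℕ =>
        (∫ ω, ((hawkinsT (α ω) l k i n : ℝ)) ^ 2 ∂μ) -
          (∫ ω, (hawkinsT (α ω) l k i n : ℝ) ∂μ) ^ 2)
      =O[atTop] fun n : ℕ => (n : ℝ) ^ 2 / (Mharm n) ^ (2 * l + 6)) := by
  have hcard := card_filter_range_exists_eq hlast hmono
  have hkl : l + 2 ≤ k + 1 := by
    rw [← hcard]
    exact (Finset.card_filter_le _ _).trans (Finset.card_range _).le
  obtain ⟨b, hb⟩ := Nat.exists_eq_add_of_le hkl
  have hPN := prod_pick_eq hcard hb.symm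
  have hk : (k : ℝ) = l + 1 + b := by
    have : ((k + 1 : ℕ) : ℝ) = ((l + 2 + b : ℕ) : ℝ) := by rw [hb]
    push_cast at this
    linarith
  obtain ⟨C₁, h₁⟩ := exists_abs_integral_mul_patCount_sub_le hPN h
  obtain ⟨C₂, h₂⟩ := exists_abs_integral_patCount_sq_sub_le hPN h
  obtain ⟨C₃, h₃⟩ := exists_abs_variance_patCount_le hPN h
  have hM := fun n => (Mharm_pos n).le
  simp only [cast_hawkinsT]
  refine ⟨isBigO_of_abs_le (C := C₁) (fun n hn => ?_) fun n => div_nonneg (by positivity)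
    (pow_nonneg (hM n) _), isBigO_of_abs_le (C := C₂) (fun n hn => ?_) fun n =>
    div_nonneg (by positivity) (pow_nonneg (hM n) _), isBigO_of_abs_le (C := C₃) (fun n hn => ?_)
    fun n => div_nonneg (by positivity) (pow_nonneg (hM n) _)⟩
  · convert h₁ n hn using 2
    · congr 1
      rw [hk]
      push_cast
      simp only [div_eq_mul_inv, ← inv_pow]
      ring
    · rw [div_eq_mul_inv, ← inv_pow]
      rfl
  · convert h₂ n hn using 2
    · congr 1
      rw [hk]
      push_cast
      simp only [div_eq_mul_inv, ← inv_pow]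
      ring
    · rw [div_eq_mul_inv, ← inv_pow]
      rfl
  · convert h₃ n hn using 2
    rw [div_eq_mul_inv, ← inv_pow]
    rfl
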